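/- Let n ≥ 2 and fix signs ε_1,…,ε_n ∈ {1,−1}. There is a constant C > 0 such that for every F ∈ 𝒮(ℝ×ℝⁿ) and every unit vector e ∈ S^{n−1}, the solution u(t) = −i∫_0^t W_±(t−s)F(s)ds of the inhomogeneous problem (i∂_t + Δ_±)u = F, u(0) = 0, satisfies the inhomogeneous smoothing estimate ‖D_{e_±} u‖_{L^{∞,2}_e} ≤ C‖F‖_{L^{1,2}_e}. -/

import Mathlib

open MeasureTheory Complex Filter
open scoped FourierTransform RealInnerProductSpace ENNReal NNReal Topology

noncomputable section

namespace DNLS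

/-- Euclidean space ℝⁿ. -/
abbrev Eucl (n : ℕ) := EuclideanSpace ℝ (Fin n)

/-- The quadratic symbol `|ξ|²_± = Σ εᵢ ξᵢ²`. -/
def quadSym {n : ℕ} (ε : Fin n → ℝ) (ξ : Eucl n) : ℝ := ∑ i, ε i * (ξ i) ^ 2

/-- The signed vector `e_± = (ε₁e₁, …, εₙeₙ)`. -/
def epm {n : ℕ} (ε : Fin n → ℝ) (e : Eucl n) : Eucl n := WithLp.toLp 2 (fun i => ε i * e i)

/-- Fourier multiplier operator with symbol `m`. -/
def mulOp {n : ℕ} (m : Eucl n → ℂ) (f : Eucl n → ℂ) : Eucl n → ℂ :=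
  𝓕⁻ (fun ξ => m ξ * 𝓕 f ξ)

/-- The propagator `W_±(t)`, with `(W_±(t)φ)^(ξ) = e^{-it|ξ|²_±} φ̂(ξ)`. -/
def prop {n : ℕ} (ε : Fin n → ℝ) (t : ℝ) (φ : Eucl n → ℂ) : Eucl n → ℂ :=
  mulOp (fun ξ => Complex.exp (-Complex.I * t * quadSym ε ξ)) φ

/-- Fourier multiplier operator acting in the space variable of a space-time function. -/
def mulOpT {n : ℕ} (m : Eucl n → ℂ) (u : ℝ × Eucl n → ℂ) : ℝ × Eucl n → ℂ :=
  fun p => mulOp m (fun y => u (p.1, y)) p.2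

/-- Hypotheses on the bump function χ : even, smooth, compactly supported in (-2,2),
equal to one on [-1,1]. -/
structure IsBump (χ : ℝ → ℝ) : Prop where
  smooth : ∀ k : ℕ, ContDiff ℝ k χ
  even : ∀ s, χ (-s) = χ s
  supp : ∀ s, 2 ≤ |s| → χ s = 0
  one : ∀ s, |s| ≤ 1 → χ s = 1

/-- `ψ(s) = χ(|s|) - χ(2|s|)`. -/
def psiR (χ : ℝ → ℝ) (s : ℝ) : ℝ := χ |s| - χ (2 * |s|)

/-- `ψ_{≥k}(s) = Σ_{m ≥ k} ψ(2^{-m} s)`. -/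
def psiGe (χ : ℝ → ℝ) (k : ℤ) (s : ℝ) : ℝ :=
  ∑' m : ℤ, if k ≤ m then psiR χ ((2 : ℝ) ^ (-m) * s) else 0

/-- Littlewood–Paley projection `P_j`. -/
def proj {n : ℕ} (χ : ℝ → ℝ) (j : ℤ) (f : Eucl n → ℂ) : Eucl n → ℂ :=
  mulOp (fun ξ => (psiR χ ((2 : ℝ) ^ (-j) * ‖ξ‖) : ℂ)) f

/-- Low-frequency projection `P_{≤0} = I - Σ_{j≥1} P_j`. -/
def lowProj {n : ℕ} (χ : ℝ → ℝ) (f : Eucl n → ℂ) : Eucl n → ℂ :=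
  mulOp (fun ξ => ((1 - psiGe χ 1 ‖ξ‖ : ℝ) : ℂ)) f

/-- Directional frequency cutoff `Q^{e}_{j,l}` with symbol `ψ_{≥ j-l}(ξ·e)`. -/
def qproj {n : ℕ} (χ : ℝ → ℝ) (e : Eucl n) (j l : ℤ) (f : Eucl n → ℂ) : Eucl n → ℂ :=
  mulOp (fun ξ => ((psiGe χ (j - l) (inner ℝ ξ e : ℝ) : ℝ) : ℂ)) f

/-- `P_j` acting in the space variable of a space-time function. -/
def projT {n : ℕ} (χ : ℝ → ℝ) (j : ℤ) (u : ℝ × Eucl n → ℂ) : ℝ × Eucl n → ℂ :=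
  fun p => proj χ j (fun y => u (p.1, y)) p.2

/-- `P_{≤0}` acting in the space variable of a space-time function. -/
def lowProjT {n : ℕ} (χ : ℝ → ℝ) (u : ℝ × Eucl n → ℂ) : ℝ × Eucl n → ℂ :=
  fun p => lowProj χ (fun y => u (p.1, y)) p.2

/-- `Q^{e}_{j,l}` acting in the space variable of a space-time function. -/
def qprojT {n : ℕ} (χ : ℝ → ℝ) (e : Eucl n) (j l : ℤ) (u : ℝ × Eucl n → ℂ) :
    ℝ × Eucl n → ℂ :=
  fun p => qproj χ e j l (fun y => u (p.1, y)) p.2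

/-- The hyperplane `P_e = {ξ : ξ·e = 0}`. -/
def hyperplane {n : ℕ} (e : Eucl n) : Submodule ℝ (Eucl n) := (ℝ ∙ e)ᗮ

/-- Inner part of the anisotropic norm: the `L^q` norm over `P_e × ℝ` of
`(t,v) ↦ u(t, re + v)`. -/
def innerQ {n : ℕ} (q : ℝ≥0∞) (e : Eucl n) (u : ℝ × Eucl n → ℂ) (r : ℝ) : ℝ≥0∞ :=
  eLpNorm (fun tv : ℝ × (hyperplane e) => u (tv.1, r • e + (tv.2 : Eucl n))) q volume

/-- The anisotropic norm `‖u‖_{L^{p,q}_e}`. -/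
def aniNorm {n : ℕ} (p q : ℝ≥0∞) (e : Eucl n) (u : ℝ × Eucl n → ℂ) : ℝ≥0∞ :=
  if p = ∞ then essSup (innerQ q e u) volume
  else (∫⁻ r : ℝ, innerQ q e u r ^ p.toReal) ^ (1 / p.toReal)

/-- The mixed space-time norm `‖u‖_{L^q_t L^r_x}`. -/
def mixNorm {n : ℕ} (q r : ℝ≥0∞) (u : ℝ × Eucl n → ℂ) : ℝ≥0∞ :=
  if q = ∞ then essSup (fun t => eLpNorm (fun x => u (t, x)) r volume) volume
  else (∫⁻ t : ℝ, eLpNorm (fun x => u (t, x)) r volume ^ q.toReal) ^ (1 / q.toReal)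

/-- `2^a` as an extended nonnegative real. -/
def tp (a : ℝ) : ℝ≥0∞ := ENNReal.ofReal ((2 : ℝ) ^ a)

/-- Homogeneous Besov norm `‖φ‖_{Ḃ^s_{2,1}}`. -/
def homBesov {n : ℕ} (χ : ℝ → ℝ) (s : ℝ) (φ : Eucl n → ℂ) : ℝ≥0∞ :=
  ∑' j : ℤ, tp (s * j) * eLpNorm (proj χ j φ) 2 volume

/-- Inhomogeneous Besov norm `‖φ‖_{B^s_{2,1}}`. -/
def besov {n : ℕ} (χ : ℝ → ℝ) (s : ℝ) (φ : Eucl n → ℂ) : ℝ≥0∞ :=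
  eLpNorm (lowProj χ φ) 2 volume
    + ∑' j : ℕ, tp (s * (j + 1)) * eLpNorm (proj χ (j + 1) φ) 2 volume

/-- The supremum over unit vectors, auxiliary notation. -/
def sphSup {n : ℕ} (g : Eucl n → ℝ≥0∞) : ℝ≥0∞ := ⨆ (e : Eucl n) (_ : ‖e‖ = 1), g e

/-- `‖P_j u‖_{M^m_j} = 2^{-(n/2-1/(m-1))j} sup_e ‖P_j u‖_{L^{m-1,∞}_e}`. -/
def MmJ {n : ℕ} (χ : ℝ → ℝ) (m : ℕ) (j : ℤ) (u : ℝ × Eucl n → ℂ) : ℝ≥0∞ :=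
  tp (-((n : ℝ) / 2 - 1 / ((m : ℝ) - 1)) * j)
    * sphSup (fun e => aniNorm ((m : ℝ≥0∞) - 1) ∞ e (projT χ j u))

/-- `‖P_j u‖_{S_j} = 2^{j/2} sup_e ‖P_j Q^{e_±}_{j,20} u‖_{L^{∞,2}_e}`. -/
def SJ {n : ℕ} (ε : Fin n → ℝ) (χ : ℝ → ℝ) (j : ℤ) (u : ℝ × Eucl n → ℂ) : ℝ≥0∞ :=
  tp ((j : ℝ) / 2)
    * sphSup (fun e => aniNorm ∞ 2 e (projT χ j (qprojT χ (epm ε e) j 20 u)))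

/-- `‖P_j u‖_{T_j} = ‖P_j u‖_{L^∞_t L²_x}`. -/
def TJ {n : ℕ} (χ : ℝ → ℝ) (j : ℤ) (u : ℝ × Eucl n → ℂ) : ℝ≥0∞ :=
  mixNorm ∞ 2 (projT χ j u)

/-- `‖P_j u‖_{Y^m_j}`. -/
def YmJ {n : ℕ} (ε : Fin n → ℝ) (χ : ℝ → ℝ) (m : ℕ) (j : ℤ) (u : ℝ × Eucl n → ℂ) : ℝ≥0∞ :=
  MmJ χ m j u + SJ ε χ j u + TJ χ j u

/-- The homogeneous resolution norm `‖u‖_{Ż^σ_{2,1}}`. -/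
def Zhom {n : ℕ} (ε : Fin n → ℝ) (χ : ℝ → ℝ) (m : ℕ) (σ : ℝ) (u : ℝ × Eucl n → ℂ) : ℝ≥0∞ :=
  ∑' j : ℤ, tp (σ * j) * YmJ ε χ m j u

/-- `N_j`-norm of a function: `2^{-j/2} sup_e ‖f‖_{L^{1,2}_e}`. -/
def NJraw {n : ℕ} (j : ℤ) (f : ℝ × Eucl n → ℂ) : ℝ≥0∞ :=
  tp (-(j : ℝ) / 2) * sphSup (fun e => aniNorm 1 2 e f)

/-- `‖P_j u‖_{N_j}`. -/
def NJ {n : ℕ} (χ : ℝ → ℝ) (j : ℤ) (u : ℝ × Eucl n → ℂ) : ℝ≥0∞ :=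
  NJraw j (projT χ j u)

/-- The homogeneous nonlinear norm `‖F‖_{Ṅ^σ_{2,1}}`. -/
def Nhom {n : ℕ} (χ : ℝ → ℝ) (σ : ℝ) (F : ℝ × Eucl n → ℂ) : ℝ≥0∞ :=
  ∑' j : ℤ, tp (σ * j) * NJ χ j F

/-- `‖P_j u‖_{T̃_j} = ‖P_j u‖_{L^∞_t L²_x} + ‖P_j u‖_{L^{2+4/n}_{t,x}}`. -/
def TtilJ {n : ℕ} (χ : ℝ → ℝ) (j : ℤ) (u : ℝ × Eucl n → ℂ) : ℝ≥0∞ :=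
  mixNorm ∞ 2 (projT χ j u)
    + eLpNorm (projT χ j u) (ENNReal.ofReal (2 + 4 / (n : ℝ))) volume

/-- `‖P_j u‖_{M̃_j} = sup_{p ∈ ℤ, p ≥ 2, np ≥ 6} sup_e 2^{(n/2-1/p)j}‖P_j u‖_{L^{p,∞}_e}`. -/
def MtilJ {n : ℕ} (χ : ℝ → ℝ) (j : ℤ) (u : ℝ × Eucl n → ℂ) : ℝ≥0∞ :=
  ⨆ (p : ℕ) (_ : 2 ≤ p ∧ 6 ≤ n * p),
    sphSup (fun e => tp (((n : ℝ) / 2 - 1 / (p : ℝ)) * j) * aniNorm (p : ℝ≥0∞) ∞ e (projT χ j u))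

/-- `‖P_j u‖_{Ỹ_j}`. -/
def YtilJ {n : ℕ} (ε : Fin n → ℝ) (χ : ℝ → ℝ) (j : ℤ) (u : ℝ × Eucl n → ℂ) : ℝ≥0∞ :=
  MtilJ χ j u + SJ ε χ j u + TtilJ χ j u

/-- The inhomogeneous resolution norm `‖u‖_{Z̃^σ_{2,1}}`. -/
def Ztil {n : ℕ} (ε : Fin n → ℝ) (χ : ℝ → ℝ) (σ : ℝ) (u : ℝ × Eucl n → ℂ) : ℝ≥0∞ :=
  (∑' j : ℤ, if j ≤ 0 then YtilJ ε χ j u ^ 2 else 0) ^ ((1 : ℝ) / 2)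
    + ∑' j : ℤ, if 1 ≤ j then tp (σ * j) * YtilJ ε χ j u else 0

/-- `‖f‖_{Ñ_j}`: infimum over decompositions `f = v + w`. -/
def NtilJraw {n : ℕ} (j : ℤ) (f : ℝ × Eucl n → ℂ) : ℝ≥0∞ :=
  ⨅ (vw : (ℝ × Eucl n → ℂ) × (ℝ × Eucl n → ℂ)) (_ : f = vw.1 + vw.2),
    NJraw j vw.1 + eLpNorm vw.2 (ENNReal.ofReal ((2 * (n : ℝ) + 4) / ((n : ℝ) + 4))) volume

/-- The inhomogeneous nonlinear norm `‖F‖_{Ñ^σ_{2,1}}`. -/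
def Ntil {n : ℕ} (χ : ℝ → ℝ) (σ : ℝ) (F : ℝ × Eucl n → ℂ) : ℝ≥0∞ :=
  (∑' j : ℤ, if j ≤ 0 then NtilJraw j (projT χ j F) ^ 2 else 0) ^ ((1 : ℝ) / 2)
    + ∑' j : ℤ, if 1 ≤ j then tp (σ * j) * NtilJraw j (projT χ j F) else 0

/-- `k`-th spatial partial derivative of a space-time function. -/
def pd {n : ℕ} (k : ℕ) (u : ℝ × Eucl n → ℂ) (p : ℝ × Eucl n) : ℂ :=
  if h : k < n then fderiv ℝ (fun y => u (p.1, y)) p.2 (EuclideanSpace.single ⟨k, h⟩ (1 : ℝ))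
  else 0

/-- The retarded Duhamel integral `∫_0^t W_±(t-s) G(s) ds`. -/
def duhamel {n : ℕ} (ε : Fin n → ℝ) (G : ℝ × Eucl n → ℂ) (p : ℝ × Eucl n) : ℂ :=
  ∫ s in (0 : ℝ)..p.1, prop ε (p.1 - s) (fun y => G (s, y)) p.2

/-- Admissible Strichartz pair: `2/q = n(1/2 - 1/r)`, `q, r ≥ 2`, and `q ≠ 2` when `n = 2`. -/
def Admissible (n : ℕ) (q r : ℝ) : Prop :=
  2 / q = (n : ℝ) * (1 / 2 - 1 / r) ∧ 2 ≤ q ∧ 2 ≤ r ∧ (n = 2 → q ≠ 2)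

/-- Value of a power series with coefficients `c` at `z`. -/
def polyVal {d : ℕ} (c : (Fin d →₀ ℕ) → ℂ) (z : Fin d → ℂ) : ℂ :=
  ∑' β : Fin d →₀ ℕ, c β * ∏ i, z i ^ β i

/-- The argument vector `(u, ū, ∇u, ∇ū)` of the general nonlinearity. -/
def nlArg {n : ℕ} (u : ℝ × Eucl n → ℂ) (p : ℝ × Eucl n) (i : Fin (2 * n + 2)) : ℂ :=
  if (i : ℕ) = 0 then u p
  else if (i : ℕ) = 1 then starRingEnd ℂ (u p)
  else if (i : ℕ) < n + 2 then pd ((i : ℕ) - 2) u p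
  else pd ((i : ℕ) - (n + 2)) (fun q => starRingEnd ℂ (u q)) p

/-- The argument vector `(∇u, ∇ū)` of a nonlinearity in `2n` variables. -/
def gradArg {n : ℕ} (u : ℝ × Eucl n → ℂ) (p : ℝ × Eucl n) (i : Fin (2 * n)) : ℂ :=
  if (i : ℕ) < n then pd (i : ℕ) u p
  else pd ((i : ℕ) - n) (fun q => starRingEnd ℂ (u q)) p

end DNLS
open DNLS

section Plancherel

variable {V : Type*} [NormedAddCommGroup V] [InnerProductSpace ℝ V] [FiniteDimensional ℝ V]
  [MeasurableSpace V] [BorelSpace V]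

/-- The Fourier transform on `L²` is given by the Fourier integral on `L¹ ∩ L²`. -/
theorem coeFn_fourier_toLp {f : V → ℂ} (hf : Integrable f) (hf2 : MemLp f 2) :
    (𝓕 (hf2.toLp f) : Lp ℂ 2 (volume : Measure V)) =ᵐ[volume] 𝓕 f := by
  have hcont : Continuous (𝓕 f) :=
    VectorFourier.fourierIntegral_continuous Real.continuous_fourierChar
      (by exact continuous_inner) hf
  have hloc : LocallyIntegrable
      (fun x => (𝓕 (hf2.toLp f) : Lp ℂ 2 (volume : Measure V)) x - 𝓕 f x) volume :=
    ((Lp.memLp _).locallyIntegrable (by norm_num)).sub hcont.locallyIntegrable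
  have key : ∀ᵐ x, (𝓕 (hf2.toLp f) : Lp ℂ 2 (volume : Measure V)) x - 𝓕 f x = 0 := by
    apply ae_eq_zero_of_integral_contDiff_smul_eq_zero hloc
    intro g g_smooth g_cpt
    have hg₁ : HasCompactSupport (Complex.ofRealCLM ∘ g) := g_cpt.comp_left rfl
    have hg₂ : ContDiff ℝ ((⊤ : ℕ∞) : WithTop ℕ∞) (Complex.ofRealCLM ∘ g) := by fun_prop
    set θ := hg₁.toSchwartzMap hg₂ with hθ
    have h1 : ∫ x, g x • (𝓕 (hf2.toLp f) : Lp ℂ 2 (volume : Measure V)) x = ∫ x, (𝓕 θ) x • f x := by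
      calc _ = ((𝓕 (hf2.toLp f) : Lp ℂ 2 (volume : Measure V)) : TemperedDistribution V ℂ) θ := by
            rw [Lp.toTemperedDistribution_apply]; simp [hθ]
        _ = ∫ x, (𝓕 θ) x • hf2.toLp f x := by
            rw [← Lp.fourier_toTemperedDistribution_eq, TemperedDistribution.fourier_apply,
              Lp.toTemperedDistribution_apply]
        _ = _ := by
            apply integral_congr_ae
            filter_upwards [hf2.coeFn_toLp] with x hx
            rw [hx]
    have h2 : ∫ x, (𝓕 θ) x • f x = ∫ x, g x • 𝓕 f x := by
      have := VectorFourier.integral_fourierIntegral_smul_eq_flip (μ := (volume : Measure V))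
        (ν := (volume : Measure V)) (L := innerₗ V) (f := (θ : V → ℂ)) (g := f)
        Real.continuous_fourierChar (by exact continuous_inner) θ.integrable hf
      rw [flip_innerₗ] at this
      rw [SchwartzMap.fourier_coe]
      refine this.trans ?_
      simp only [hθ]
      rfl
    have hc : Continuous g := g_smooth.continuous
    have i1 : Integrable (fun x => g x • (𝓕 (hf2.toLp f) : Lp ℂ 2 (volume : Measure V)) x) :=
      ((Lp.memLp _).locallyIntegrable (by norm_num)).integrable_smul_left_of_hasCompactSupport
        hc g_cpt
    have i2 : Integrable (fun x => g x • 𝓕 f x) :=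
      hcont.locallyIntegrable.integrable_smul_left_of_hasCompactSupport hc g_cpt
    simp_rw [smul_sub]
    rw [integral_sub i1 i2, h1, h2, sub_self]
  filter_upwards [key] with x hx using sub_eq_zero.mp hx

theorem eLpNorm_two_sq {α : Type*} [MeasurableSpace α] (μ : Measure α) (f : α → ℂ) :
    eLpNorm f 2 μ ^ 2 = ∫⁻ x, ‖f x‖ₑ ^ 2 ∂μ := by
  have := eLpNorm_nnreal_pow_eq_lintegral (p := 2) (μ := μ) (f := f) (by norm_num)
  simpa using this

/-- **Plancherel's theorem** on `L¹ ∩ L²`. -/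
theorem lintegral_enorm_fourier_sq {f : V → ℂ} (hf : Integrable f) (hf2 : MemLp f 2) :
    ∫⁻ x, ‖𝓕 f x‖ₑ ^ 2 = ∫⁻ x, ‖f x‖ₑ ^ 2 := by
  rw [← eLpNorm_two_sq, ← eLpNorm_two_sq, ← eLpNorm_congr_ae (coeFn_fourier_toLp hf hf2),
    ← Lp.enorm_def, ← eLpNorm_congr_ae hf2.coeFn_toLp, ← Lp.enorm_def,
    ← ofReal_norm, ← ofReal_norm, Lp.norm_fourier_eq]

theorem lintegral_enorm_fourier_sq_le {f : V → ℂ} (hf : Integrable f) :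
    ∫⁻ x, ‖𝓕 f x‖ₑ ^ 2 ≤ ∫⁻ x, ‖f x‖ₑ ^ 2 := by
  by_cases h : MemLp f 2
  · exact (lintegral_enorm_fourier_sq hf h).le
  · rw [← eLpNorm_two_sq volume f]
    have : eLpNorm f 2 volume = ∞ := by
      by_contra h'
      exact h ⟨hf.1, lt_top_iff_ne_top.2 h'⟩
    simp [this]

theorem lintegral_enorm_fourierInv_sq_le {f : V → ℂ} (hf : Integrable f) :
    ∫⁻ x, ‖𝓕⁻ f x‖ₑ ^ 2 ≤ ∫⁻ x, ‖f x‖ₑ ^ 2 := by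
  refine le_trans (le_of_eq ?_) (lintegral_enorm_fourier_sq_le hf)
  simp_rw [Real.fourierInv_eq_fourier_neg]
  exact (Measure.measurePreserving_neg volume).lintegral_comp_emb
    (MeasurableEquiv.neg V).measurableEmbedding (fun x => ‖𝓕 f x‖ₑ ^ 2)

end Plancherel

/-- **Minkowski's integral inequality** in `L²`. -/
theorem lintegral_lintegral_sq_le {α β : Type*} [MeasurableSpace α] [MeasurableSpace β]
    (μ : Measure α) (ν : Measure β) [SFinite μ] [SFinite ν] {f : α → β → ℝ≥0∞}
    (hf : Measurable (Function.uncurry f)) :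
    ∫⁻ a, (∫⁻ b, f a b ∂ν) ^ 2 ∂μ ≤ (∫⁻ b, (∫⁻ a, f a b ^ 2 ∂μ) ^ (1 / 2 : ℝ) ∂ν) ^ 2 := by
  have h1 : ∀ a, Measurable (f a) := fun a => hf.of_uncurry_left
  have h2 : ∀ b, Measurable (fun a => f a b) := fun b => hf.of_uncurry_right
  have hN : Measurable (fun b => (∫⁻ a, f a b ^ 2 ∂μ) ^ (1 / 2 : ℝ)) :=
    (Measurable.lintegral_prod_left' (f := fun p : α × β => f p.1 p.2 ^ 2)
      (hf.pow_const 2)).pow_const _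
  calc ∫⁻ a, (∫⁻ b, f a b ∂ν) ^ 2 ∂μ
      = ∫⁻ a, ∫⁻ b, ∫⁻ b', f a b * f a b' ∂ν ∂ν ∂μ := by
        congr with a
        rw [sq, ← lintegral_mul_const _ (h1 a)]
        congr with b
        rw [lintegral_const_mul _ (h1 a)]
    _ = ∫⁻ b, ∫⁻ a, ∫⁻ b', f a b * f a b' ∂ν ∂μ ∂ν := by
        apply lintegral_lintegral_swap
        refine (Measurable.lintegral_prod_right'
          (f := fun p : (α × β) × β => f p.1.1 p.1.2 * f p.1.1 p.2) ?_).aemeasurable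
        exact (hf.comp measurable_fst).mul
          (hf.comp ((measurable_fst.comp measurable_fst).prodMk measurable_snd))
    _ = ∫⁻ b, ∫⁻ b', ∫⁻ a, f a b * f a b' ∂μ ∂ν ∂ν := by
        congr with b
        apply lintegral_lintegral_swap
        exact (((h2 b).comp measurable_fst).mul hf).aemeasurable
    _ ≤ ∫⁻ b, ∫⁻ b', (∫⁻ a, f a b ^ 2 ∂μ) ^ (1 / 2 : ℝ) * (∫⁻ a, f a b' ^ 2 ∂μ) ^ (1 / 2 : ℝ)
          ∂ν ∂ν := by
        gcongr with b b'
        have := ENNReal.lintegral_mul_le_Lp_mul_Lq μ Real.HolderConjugate.two_two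
          (h2 b).aemeasurable (h2 b').aemeasurable
        simpa using this
    _ = _ := by
        rw [sq, ← lintegral_mul_const _ hN]
        congr with b
        rw [lintegral_const_mul _ hN]

section Resolvent

theorem ofReal_sub_ne_zero {z : ℂ} (hz : z.im ≠ 0) (ρ : ℝ) : (ρ : ℂ) - z ≠ 0 := by
  intro h
  apply hz
  rw [← sub_eq_zero.mp h, ofReal_im]

theorem integrable_exp_mul_inv_sub_mul {z : ℂ} (hz : z.im ≠ 0) (x : ℝ) {g : ℝ → ℂ}
    (hg : Integrable g) :
    Integrable (fun ρ : ℝ => cexp (2 * Real.pi * x * ρ * I) * ((ρ : ℂ) - z)⁻¹ * g ρ) := by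
  refine hg.bdd_mul (c := |z.im|⁻¹) ?_ (ae_of_all _ fun ρ => ?_)
  · refine Continuous.aestronglyMeasurable (Continuous.mul (by fun_prop) ?_)
    exact Continuous.inv₀ (by fun_prop) (ofReal_sub_ne_zero hz)
  · have h1 : ‖cexp (2 * Real.pi * x * ρ * I)‖ = 1 := by
      have := norm_exp_ofReal_mul_I (2 * Real.pi * x * ρ)
      simpa using this
    rw [norm_mul, h1, one_mul, norm_inv]
    apply inv_anti₀ (abs_pos.2 hz)
    have := abs_im_le_norm ((ρ : ℂ) - z)
    simpa using this

theorem inv_ofReal_sub_eq_integral {z : ℂ} {σ : ℝ} (hσ : 0 < σ * z.im) (ρ : ℝ) :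
    ((ρ : ℂ) - z)⁻¹ = 2 * Real.pi * I * σ *
      ∫ y in Set.Ioi (0 : ℝ), cexp (-(2 * Real.pi * I * σ * (ρ - z)) * y) := by
  have hz : z.im ≠ 0 := by rintro h; simp [h] at hσ
  have hσ0 : σ ≠ 0 := by rintro rfl; simp at hσ
  have hne := ofReal_sub_ne_zero hz ρ
  rw [integral_exp_mul_complex_Ioi]
  · have : (σ : ℂ) ≠ 0 := by exact_mod_cast hσ0
    have hpi : (Real.pi : ℂ) ≠ 0 := by exact_mod_cast Real.pi_ne_zero
    simp
    field_simp
    rw [I_sq, neg_neg]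
  · have : (-(2 * Real.pi * I * σ * (ρ - z))).re = -(2 * Real.pi * (σ * z.im)) := by
      simp
      ring
    rw [this]
    have := Real.pi_pos
    simp only [Left.neg_neg_iff]
    positivity

theorem enorm_integral_exp_mul_inv_sub_mul_fourier_le {z : ℂ} (hz : z.im ≠ 0) (x : ℝ)
    {φ : ℝ → ℂ} (hc : Continuous φ) (hi : Integrable φ) (hF : Integrable (𝓕 φ)) :
    ‖∫ ρ : ℝ, cexp (2 * Real.pi * x * ρ * I) * ((ρ : ℂ) - z)⁻¹ * 𝓕 φ ρ‖ₑ ≤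
      ENNReal.ofReal (2 * Real.pi) * ∫⁻ r, ‖φ r‖ₑ := by
  obtain ⟨σ, hσ1, hσ⟩ : ∃ σ : ℝ, (σ = 1 ∨ σ = -1) ∧ 0 < σ * z.im := by
    rcases lt_or_gt_of_ne hz with h | h
    · exact ⟨-1, Or.inr rfl, by linarith⟩
    · exact ⟨1, Or.inl rfl, by linarith⟩
  have hpi := Real.pi_pos
  let K : ℝ → ℝ → ℂ := fun ρ y =>
    cexp (2 * Real.pi * x * ρ * I) * cexp (-(2 * Real.pi * I * σ * (ρ - z)) * y) * 𝓕 φ ρ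
  have hnK : ∀ ρ y, ‖K ρ y‖ = ‖𝓕 φ ρ‖ * Real.exp (-(2 * Real.pi * (σ * z.im)) * y) := by
    intro ρ y
    have h2 : (2 * Real.pi * x * ρ * I : ℂ).re = 0 := by simp
    have h3 : (-(2 * Real.pi * I * σ * (ρ - z)) * y : ℂ).re
        = -(2 * Real.pi * (σ * z.im)) * y := by
      simp
      left; ring
    simp only [K, norm_mul, norm_exp, h2, h3]
    simp [mul_comm]
  have hK : Integrable (Function.uncurry K) (volume.prod (volume.restrict (Set.Ioi (0 : ℝ)))) := by
    have h1 : Integrable (fun y : ℝ => Real.exp (-(2 * Real.pi * (σ * z.im)) * y))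
        (volume.restrict (Set.Ioi (0 : ℝ))) :=
      integrableOn_exp_mul_Ioi (by simp only [Left.neg_neg_iff]; positivity) 0
    refine (hF.norm.mul_prod h1).mono' ?_ (ae_of_all _ fun p => (hnK p.1 p.2).le)
    refine AEStronglyMeasurable.mul (Continuous.aestronglyMeasurable (by fun_prop)) ?_
    exact hF.aestronglyMeasurable.comp_fst
  have hin : ∀ y : ℝ, ∫ ρ, K ρ y = cexp (2 * Real.pi * I * σ * z * y) * φ (x - σ * y) := by
    intro y
    have h1 := hi.fourierInv_fourier_eq hF (v := x - σ * y) hc.continuousAt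
    rw [← h1, Real.fourierInv_eq', ← integral_const_mul]
    congr with ρ
    simp only [K, smul_eq_mul, ← mul_assoc, ← Complex.exp_add]
    congr 2
    simp
    ring
  calc ‖∫ ρ : ℝ, cexp (2 * Real.pi * x * ρ * I) * ((ρ : ℂ) - z)⁻¹ * 𝓕 φ ρ‖ₑ
      = ‖2 * Real.pi * I * σ * ∫ ρ, ∫ y in Set.Ioi (0 : ℝ), K ρ y‖ₑ := by
        rw [← integral_const_mul]
        congr with ρ
        rw [inv_ofReal_sub_eq_integral hσ ρ]
        simp only [K]
        rw [integral_mul_const, integral_const_mul]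
        ring
    _ = ENNReal.ofReal (2 * Real.pi) *
          ‖∫ y in Set.Ioi (0 : ℝ), cexp (2 * Real.pi * I * σ * z * y) * φ (x - σ * y)‖ₑ := by
        rw [integral_integral_swap hK, enorm_mul]
        congr 1
        · rw [← ofReal_norm]
          congr 1
          rcases hσ1 with rfl | rfl <;> simp [abs_of_pos hpi]
        · simp_rw [hin]
    _ ≤ _ := by
        gcongr
        calc ‖∫ y in Set.Ioi (0 : ℝ), cexp (2 * Real.pi * I * σ * z * y) * φ (x - σ * y)‖ₑ
            ≤ ∫⁻ y in Set.Ioi (0 : ℝ), ‖cexp (2 * Real.pi * I * σ * z * y) * φ (x - σ * y)‖ₑ :=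
              enorm_integral_le_lintegral_enorm _
          _ ≤ ∫⁻ y in Set.Ioi (0 : ℝ), ‖φ (x - σ * y)‖ₑ := by
              refine setLIntegral_mono' measurableSet_Ioi fun y hy => ?_
              rw [enorm_mul]
              refine mul_le_of_le_one_left' ?_
              rw [← ofReal_norm, norm_exp, ENNReal.ofReal_le_one, Real.exp_le_one_iff]
              have : (2 * Real.pi * I * σ * z * y : ℂ).re = -(2 * Real.pi * (σ * z.im) * y) := by
                simp
                ring_nf
                simp
              rw [this, neg_nonpos]
              have : 0 < y := hy
              positivity
          _ ≤ ∫⁻ y, ‖φ (x - σ * y)‖ₑ := setLIntegral_le_lintegral _ _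
          _ = ∫⁻ r, ‖φ r‖ₑ := by
              rcases hσ1 with rfl | rfl
              · simpa using lintegral_sub_left_eq_self (fun r => ‖φ r‖ₑ) x
              · simpa using lintegral_add_left_eq_self (fun r => ‖φ r‖ₑ) x

/-- The logarithmic derivative of a real quadratic polynomial, shifted off the real axis, acts as a
Fourier multiplier from `L¹` to `L^∞`, with a norm independent of the polynomial. -/
theorem enorm_integral_exp_mul_logDeriv_mul_fourier_le (a b : ℝ) {w : ℂ} (hw : w.im ≠ 0) (x : ℝ)
    {φ : ℝ → ℂ} (hc : Continuous φ) (hi : Integrable φ) (hF : Integrable (𝓕 φ)) :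
    ‖∫ ρ : ℝ, cexp (2 * Real.pi * x * ρ * I) *
        ((a * ρ + b) / (a * ρ ^ 2 + 2 * b * ρ + w)) * 𝓕 φ ρ‖ₑ ≤
      ENNReal.ofReal (2 * Real.pi) * ∫⁻ r, ‖φ r‖ₑ := by
  have hP : ∀ ρ : ℝ, (a * ρ ^ 2 + 2 * b * ρ + w : ℂ) ≠ 0 := by
    intro ρ h
    apply hw
    have := congrArg Complex.im h
    simpa [← ofReal_pow] using this
  have half : ∀ z : ℂ, z.im ≠ 0 →
      ‖(1 / 2 : ℂ) * ∫ ρ : ℝ, cexp (2 * Real.pi * x * ρ * I) * ((ρ : ℂ) - z)⁻¹ * 𝓕 φ ρ‖ₑ ≤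
      1 / 2 * (ENNReal.ofReal (2 * Real.pi) * ∫⁻ r, ‖φ r‖ₑ) := by
    intro z hz
    rw [enorm_mul]
    refine mul_le_mul' (le_of_eq ?_) (enorm_integral_exp_mul_inv_sub_mul_fourier_le hz x hc hi hF)
    rw [← ofReal_norm]
    simp [ENNReal.ofReal_inv_of_pos]
  by_cases ha : a = 0
  · by_cases hb : b = 0
    · simp [ha, hb]
    have hb' : (b : ℂ) ≠ 0 := by exact_mod_cast hb
    have hz : (-w / (2 * b)).im ≠ 0 := by
      have : (-w / (2 * b) : ℂ) = ((2 * b)⁻¹ : ℝ) * -w := by push_cast; field_simp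
      rw [this, im_ofReal_mul]
      simp [hw, hb]
    refine le_trans (le_of_eq ?_) ((half _ hz).trans ?_)
    · rw [← integral_const_mul]
      congr with ρ
      have h1 := hP ρ
      have h2 := ofReal_sub_ne_zero hz ρ
      have : ((a * ρ + b) / (a * ρ ^ 2 + 2 * b * ρ + w) : ℂ) =
          1 / 2 * ((ρ : ℂ) - -w / (2 * b))⁻¹ := by
        simp only [ha, ofReal_zero, zero_mul, zero_add] at h1 ⊢
        have h3 : (ρ : ℂ) - -w / (2 * b) = (2 * b * ρ + w) / (2 * b) := by
          field_simp; ring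
        rw [h3]
        field_simp
      rw [this]
      ring
    · refine mul_le_of_le_one_left' ?_
      simp
  · have ha' : (a : ℂ) ≠ 0 := by exact_mod_cast ha
    obtain ⟨s, hs⟩ : ∃ s : ℂ, (b : ℂ) ^ 2 - a * w = s ^ 2 := by
      obtain ⟨s, hs⟩ := IsAlgClosed.exists_pow_nat_eq ((b : ℂ) ^ 2 - a * w) zero_lt_two
      exact ⟨s, hs.symm⟩
    have hroot : ∀ s : ℂ, (b : ℂ) ^ 2 - a * w = s ^ 2 → ((-b + s) / a).im ≠ 0 := by
      intro s hs h
      set z := (-b + s) / (a : ℂ) with hz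
      have hzr : ((z.re : ℝ) : ℂ) = z := by
        apply Complex.ext <;> simp [h]
      apply hP z.re
      rw [hzr, hz]
      field_simp
      linear_combination -hs
    have hz1 := hroot s hs
    have hz2 := hroot (-s) (by rw [hs]; ring)
    have hsum : ∀ ρ : ℝ, ((a * ρ + b) / (a * ρ ^ 2 + 2 * b * ρ + w) : ℂ) =
        1 / 2 * (((ρ : ℂ) - (-b + s) / a)⁻¹ + ((ρ : ℂ) - (-b + -s) / a)⁻¹) := by
      intro ρ
      have h1 := hP ρ
      have h2 := ofReal_sub_ne_zero hz1 ρ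
      have h3 := ofReal_sub_ne_zero hz2 ρ
      have h4 : (a * ρ ^ 2 + 2 * b * ρ + w : ℂ) =
          a * ((ρ - (-b + s) / a) * (ρ - (-b + -s) / a)) := by
        field_simp
        linear_combination -hs
      have h5 : (a * ρ + b : ℂ) =
          1 / 2 * (a * ((ρ - (-b + s) / a) + (ρ - (-b + -s) / a))) := by
        field_simp
        ring
      rw [h4, h5]
      generalize (ρ : ℂ) - (-b + s) / a = u at *
      generalize (ρ : ℂ) - (-b + -s) / a = v at *
      field_simp
      ring
    have i1 := integrable_exp_mul_inv_sub_mul hz1 x hF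
    have i2 := integrable_exp_mul_inv_sub_mul hz2 x hF
    calc _ = ‖(1 / 2 : ℂ) * (∫ ρ : ℝ, cexp (2 * Real.pi * x * ρ * I) *
              ((ρ : ℂ) - (-b + s) / a)⁻¹ * 𝓕 φ ρ) +
            (1 / 2 : ℂ) * ∫ ρ : ℝ, cexp (2 * Real.pi * x * ρ * I) *
              ((ρ : ℂ) - (-b + -s) / a)⁻¹ * 𝓕 φ ρ‖ₑ := by
          rw [← mul_add, ← integral_add i1 i2, ← integral_const_mul]
          congr with ρ
          rw [hsum]
          ring
      _ ≤ _ := (enorm_add_le _ _).trans (add_le_add (half _ hz1) (half _ hz2))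
      _ = _ := by rw [← add_mul, ENNReal.add_halves, one_mul]

end Resolvent

theorem norm_cexp_neg_I_mul_mul (t p : ℝ) : ‖cexp (-I * t * p)‖ = 1 := by
  rw [Complex.norm_exp]; simp

theorem integrableOn_cexp_neg_mul_mul {z : ℂ} (hz : 0 < z.re) {f : ℝ → ℂ}
    (hf : Continuous f) {D : ℝ} (hD : ∀ s, ‖f s‖ ≤ D) :
    IntegrableOn (fun s : ℝ => cexp (-z * s) * f s) (Set.Ioi 0) := by
  have h := integrableOn_exp_mul_complex_Ioi (a := -z) (by simpa using hz) 0
  exact h.mul_bdd hf.aestronglyMeasurable (ae_of_all _ hD)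

theorem integrableOn_mul_cexp_neg_mul {z : ℂ} (hz : 0 < z.re) :
    IntegrableOn (fun t : ℝ => |t| * ‖cexp (-z * t)‖) (Set.Ioi 0) := by
  have h := integrableOn_rpow_mul_exp_neg_mul_rpow (p := 1) (s := 1) (b := z.re)
    (by norm_num) one_pos hz
  refine h.congr_fun (fun t ht => ?_) measurableSet_Ioi
  simp [Complex.norm_exp, abs_of_pos (Set.mem_Ioi.1 ht)]

/-- The Laplace transform of a Duhamel integral. -/
theorem integral_Ioi_cexp_mul_duhamel {z : ℂ} (hz : 0 < z.re) (p : ℝ) {f : ℝ → ℂ}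
    (hf : Continuous f) {D : ℝ} (hD : ∀ s, ‖f s‖ ≤ D) :
    ∫ t in Set.Ioi (0 : ℝ), cexp (-z * t) *
        ∫ s in (0 : ℝ)..t, cexp (-I * ((t - s : ℝ) : ℂ) * p) * f s =
      (∫ s in Set.Ioi (0 : ℝ), cexp (-z * s) * f s) * (z + I * p)⁻¹ := by
  have hre : (-(z + I * p)).re < 0 := by simpa using hz
  have h := integral_posConvolution (μ := volume) (ν := volume)
    (integrableOn_cexp_neg_mul_mul hz hf hD)
    (integrableOn_exp_mul_complex_Ioi hre 0) (ContinuousLinearMap.mul ℝ ℂ)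
  rw [integral_exp_mul_complex_Ioi hre] at h
  simp only [ContinuousLinearMap.mul_apply', ofReal_zero, mul_zero, Complex.exp_zero,
    neg_div_neg_eq, one_div] at h
  rw [← h]
  refine integral_congr_ae (ae_of_all _ fun t => ?_)
  simp only
  rw [← intervalIntegral.integral_const_mul]
  refine intervalIntegral.integral_congr fun s _ => ?_
  rw [mul_right_comm (cexp (-z * s)), ← Complex.exp_add, ← mul_assoc, ← Complex.exp_add]
  congr 2
  push_cast
  ring

/-- Regularity and decay of a family `Φ s` of functions of one variable, together with
majorants of the functions and of their Fourier transforms. -/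
structure HasFourierBounds (Φ : ℝ → ℝ → ℂ) (M : ℝ) (B D : ℝ → ℝ) : Prop where
  cont : Continuous (Function.uncurry Φ)
  bound : ∀ s r, ‖Φ s r‖ ≤ M
  integrable_left : Integrable B
  le_left : ∀ s r, ‖Φ s r‖ ≤ B r
  integrable_right : Integrable D
  integrable_abs_mul_right : Integrable (fun ρ => |ρ| * D ρ)
  fourier_le : ∀ s ρ, ‖𝓕 (Φ s) ρ‖ ≤ D ρ

namespace HasFourierBounds

variable {Φ : ℝ → ℝ → ℂ} {M : ℝ} {B D : ℝ → ℝ}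

theorem neg (h : HasFourierBounds Φ M B D) : HasFourierBounds (fun s => Φ (-s)) M B D where
  cont := h.cont.comp (continuous_fst.neg.prodMk continuous_snd)
  bound _ r := h.bound _ r
  integrable_left := h.integrable_left
  le_left _ r := h.le_left _ r
  integrable_right := h.integrable_right
  integrable_abs_mul_right := h.integrable_abs_mul_right
  fourier_le _ ρ := h.fourier_le _ ρ

theorem continuous_slice (h : HasFourierBounds Φ M B D) (s : ℝ) : Continuous (Φ s) :=
  h.cont.comp (Continuous.prodMk_right s)

theorem integrable_slice (h : HasFourierBounds Φ M B D) (s : ℝ) : Integrable (Φ s) :=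
  h.integrable_left.mono' (h.continuous_slice s).aestronglyMeasurable (ae_of_all _ (h.le_left s))

theorem continuous_fourier (h : HasFourierBounds Φ M B D) :
    Continuous (fun p : ℝ × ℝ => 𝓕 (Φ p.1) p.2) := by
  simp_rw [Real.fourier_real_eq_integral_exp_smul]
  refine continuous_of_dominated (bound := B) (fun p => ?_) (fun p => ae_of_all _ fun r => ?_)
    h.integrable_left (ae_of_all _ fun r => ?_)
  · have := h.continuous_slice p.1
    exact Continuous.aestronglyMeasurable (by fun_prop)
  · rw [norm_smul, norm_exp_ofReal_mul_I, one_mul]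
    exact h.le_left _ _
  · have : Continuous fun p : ℝ × ℝ => Φ p.1 r :=
      h.cont.comp (continuous_fst.prodMk continuous_const)
    simp only [smul_eq_mul]
    refine Continuous.mul ?_ this
    fun_prop

theorem nonneg_right (h : HasFourierBounds Φ M B D) (ρ : ℝ) : 0 ≤ D ρ :=
  (norm_nonneg _).trans (h.fourier_le 0 ρ)

theorem continuous_duhamel (h : HasFourierBounds Φ M B D) {p : ℝ → ℝ} (hp : Continuous p) :
    Continuous (fun q : ℝ × ℝ =>
      ∫ s in (0 : ℝ)..q.1, cexp (-I * ((q.1 - s : ℝ) : ℂ) * p q.2) * 𝓕 (Φ s) q.2) := by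
  refine intervalIntegral.continuous_parametric_intervalIntegral_of_continuous
    (f := fun (q : ℝ × ℝ) s => cexp (-I * ((q.1 - s : ℝ) : ℂ) * p q.2) * 𝓕 (Φ s) q.2)
    ?_ continuous_fst
  have : Continuous fun x : (ℝ × ℝ) × ℝ => 𝓕 (Φ x.2) x.1.2 :=
    h.continuous_fourier.comp (continuous_snd.prodMk (continuous_snd.comp continuous_fst))
  unfold Function.uncurry
  fun_prop

theorem norm_duhamel_le (h : HasFourierBounds Φ M B D) (p : ℝ) (t ρ : ℝ) :
    ‖∫ s in (0 : ℝ)..t, cexp (-I * ((t - s : ℝ) : ℂ) * p) * 𝓕 (Φ s) ρ‖ ≤ |t| * D ρ := by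
  have := intervalIntegral.norm_integral_le_of_norm_le_const (a := 0) (b := t) (C := D ρ)
    (f := fun s => cexp (-I * ((t - s : ℝ) : ℂ) * p) * 𝓕 (Φ s) ρ) (fun s _ => by
      rw [norm_mul, norm_cexp_neg_I_mul_mul, one_mul]
      exact h.fourier_le s ρ)
  simpa [mul_comm] using this

theorem integrable_affine_mul (h : HasFourierBounds Φ M B D) (a b : ℝ) :
    Integrable (fun ρ => |a * ρ + b| * D ρ) := by
  refine ((h.integrable_abs_mul_right.const_mul |a|).add (h.integrable_right.const_mul |b|)).mono'
    ?_ (ae_of_all _ fun ρ => ?_)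
  · exact (Continuous.aestronglyMeasurable (by fun_prop)).mul h.integrable_right.1
  · have h0 := h.nonneg_right ρ
    rw [Real.norm_eq_abs, abs_mul, abs_abs, abs_of_nonneg h0]
    have : |a * ρ + b| ≤ |a| * |ρ| + |b| := by
      rw [← abs_mul]; exact abs_add_le _ _
    simp only [Pi.add_apply]
    nlinarith

end HasFourierBounds

theorem norm_integral_Ioi_cexp_mul_le {z : ℂ} (hz : 0 < z.re) {f : ℝ → ℂ} {D : ℝ}
    (hD : ∀ s, ‖f s‖ ≤ D) : ‖∫ s in Set.Ioi (0 : ℝ), cexp (-z * s) * f s‖ ≤ z.re⁻¹ * D := by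
  have hint : IntegrableOn (fun s : ℝ => Real.exp (-z.re * s) * D) (Set.Ioi 0) :=
    (integrableOn_exp_mul_Ioi (by linarith) 0).mul_const D
  refine (norm_integral_le_of_norm_le hint (ae_of_all _ fun s => ?_)).trans (le_of_eq ?_)
  · rw [norm_mul, Complex.norm_exp]
    simp only [mul_re, neg_re, neg_im, ofReal_re, ofReal_im, mul_zero, sub_zero]
    gcongr
    exact hD s
  · rw [integral_mul_const, integral_exp_mul_Ioi (by linarith)]
    simp

namespace HasFourierBounds

variable {Φ : ℝ → ℝ → ℂ} {M : ℝ} {B D : ℝ → ℝ}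

theorem continuous_laplace (h : HasFourierBounds Φ M B D) {z : ℂ} (hz : 0 < z.re) :
    Continuous (fun r => ∫ s in Set.Ioi (0 : ℝ), cexp (-z * s) * Φ s r) := by
  refine continuous_of_dominated (bound := fun s => ‖cexp (-z * s)‖ * M) (fun r => ?_)
    (fun r => ae_of_all _ fun s => ?_)
    ((integrableOn_exp_mul_complex_Ioi (a := -z) (by simpa using hz) 0).norm.mul_const M)
    (ae_of_all _ fun s => ?_)
  · have : Continuous fun s => Φ s r := h.cont.comp (Continuous.prodMk_left r)
    exact Continuous.aestronglyMeasurable (by fun_prop)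
  · rw [norm_mul]
    gcongr
    exact h.bound s r
  · exact continuous_const.mul (h.continuous_slice s)

theorem integrable_laplace (h : HasFourierBounds Φ M B D) {z : ℂ} (hz : 0 < z.re) :
    Integrable (fun r => ∫ s in Set.Ioi (0 : ℝ), cexp (-z * s) * Φ s r) :=
  (h.integrable_left.const_mul _).mono' (h.continuous_laplace hz).aestronglyMeasurable
    (ae_of_all _ fun r => norm_integral_Ioi_cexp_mul_le hz (fun s => h.le_left s r))

theorem fourier_laplace (h : HasFourierBounds Φ M B D) {z : ℂ} (hz : 0 < z.re) (ρ : ℝ) :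
    𝓕 (fun r => ∫ s in Set.Ioi (0 : ℝ), cexp (-z * s) * Φ s r) ρ =
      ∫ s in Set.Ioi (0 : ℝ), cexp (-z * s) * 𝓕 (Φ s) ρ := by
  simp_rw [Real.fourier_real_eq_integral_exp_smul, smul_eq_mul, ← integral_const_mul]
  rw [integral_integral_swap]
  · refine integral_congr_ae (ae_of_all _ fun s => integral_congr_ae (ae_of_all _ fun r => ?_))
    simp only
    ring
  · have hm := (h.integrable_left.mul_prod
      (integrableOn_exp_mul_complex_Ioi (a := -z) (by simpa using hz) 0).norm)
    refine hm.mono' ?_ (ae_of_all _ fun q => ?_)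
    · have : Continuous fun q : ℝ × ℝ => Φ q.2 q.1 := h.cont.comp continuous_swap
      unfold Function.uncurry
      exact (Continuous.mul (by fun_prop)
        (Continuous.mul (by fun_prop) this)).aestronglyMeasurable
    · rw [Function.uncurry, norm_mul, norm_exp_ofReal_mul_I, one_mul, norm_mul, mul_comm]
      gcongr
      exact h.le_left _ _

theorem integrable_fourier_laplace (h : HasFourierBounds Φ M B D) {z : ℂ} (hz : 0 < z.re) :
    Integrable (𝓕 (fun r => ∫ s in Set.Ioi (0 : ℝ), cexp (-z * s) * Φ s r)) := by
  refine (h.integrable_right.const_mul z.re⁻¹).mono' ?_ (ae_of_all _ fun ρ => ?_)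
  · exact (VectorFourier.fourierIntegral_continuous Real.continuous_fourierChar
      (by exact continuous_inner) (h.integrable_laplace hz)).aestronglyMeasurable
  · rw [h.fourier_laplace hz]
    exact norm_integral_Ioi_cexp_mul_le hz (fun s => h.fourier_le s ρ)

end HasFourierBounds

/-- The Duhamel integral for the symbol `aρ² + 2bρ + c`, followed by the multiplier `aρ + b`,
evaluated at `(t, x)`. -/
def duhamelLine (a b c : ℝ) (Φ : ℝ → ℝ → ℂ) (t x : ℝ) : ℂ :=
  ∫ ρ : ℝ, cexp (2 * Real.pi * x * ρ * I) * (a * ρ + b) *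
    ∫ s in (0 : ℝ)..t, cexp (-I * ((t - s : ℝ) : ℂ) * ((a * ρ ^ 2 + 2 * b * ρ + c : ℝ) : ℂ)) *
      𝓕 (Φ s) ρ

namespace HasFourierBounds

variable {Φ : ℝ → ℝ → ℂ} {M : ℝ} {B D : ℝ → ℝ}

theorem continuous_integrand (h : HasFourierBounds Φ M B D) (a b c x : ℝ) :
    Continuous (fun q : ℝ × ℝ => cexp (2 * Real.pi * x * q.2 * I) * (a * q.2 + b) *
      ∫ s in (0 : ℝ)..q.1, cexp (-I * ((q.1 - s : ℝ) : ℂ) *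
        ((a * q.2 ^ 2 + 2 * b * q.2 + c : ℝ) : ℂ)) * 𝓕 (Φ s) q.2) :=
  Continuous.mul (by fun_prop)
    (h.continuous_duhamel (p := fun ρ => a * ρ ^ 2 + 2 * b * ρ + c) (by fun_prop))

theorem norm_integrand_le (h : HasFourierBounds Φ M B D) (a b c x t ρ : ℝ) :
    ‖cexp (2 * Real.pi * x * ρ * I) * (a * ρ + b) *
      ∫ s in (0 : ℝ)..t, cexp (-I * ((t - s : ℝ) : ℂ) *
        ((a * ρ ^ 2 + 2 * b * ρ + c : ℝ) : ℂ)) * 𝓕 (Φ s) ρ‖ ≤ |t| * (|a * ρ + b| * D ρ) := by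
  have h1 : ‖cexp (2 * Real.pi * x * ρ * I)‖ = 1 := by
    have := norm_exp_ofReal_mul_I (2 * Real.pi * x * ρ)
    simpa using this
  have h2 : ‖(a * ρ + b : ℂ)‖ = |a * ρ + b| := by
    rw [← Real.norm_eq_abs, ← Complex.norm_real]; push_cast; rfl
  rw [norm_mul, norm_mul, h1, h2, one_mul, mul_left_comm]
  gcongr
  exact h.norm_duhamel_le _ t ρ

theorem stronglyMeasurable_duhamelLine (h : HasFourierBounds Φ M B D) (a b c x : ℝ) :
    StronglyMeasurable (fun t => duhamelLine a b c Φ t x) :=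
  (h.continuous_integrand a b c x).stronglyMeasurable.integral_prod_right'

theorem norm_duhamelLine_le (h : HasFourierBounds Φ M B D) (a b c t x : ℝ) :
    ‖duhamelLine a b c Φ t x‖ ≤ |t| * ∫ ρ, |a * ρ + b| * D ρ := by
  rw [← integral_const_mul]
  exact norm_integral_le_of_norm_le ((h.integrable_affine_mul a b).const_mul _)
    (ae_of_all _ (h.norm_integrand_le a b c x t))

theorem integral_Ioi_cexp_mul_duhamelLine (h : HasFourierBounds Φ M B D) (a b c x : ℝ)
    {z : ℂ} (hz : 0 < z.re) :
    ∫ t in Set.Ioi (0 : ℝ), cexp (-z * t) * duhamelLine a b c Φ t x =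
      -I * ∫ ρ : ℝ, cexp (2 * Real.pi * x * ρ * I) *
        ((a * ρ + b) / (a * ρ ^ 2 + 2 * b * ρ + (c - I * z))) *
          𝓕 (fun r => ∫ s in Set.Ioi (0 : ℝ), cexp (-z * s) * Φ s r) ρ := by
  simp_rw [duhamelLine, ← integral_const_mul]
  rw [integral_integral_swap]
  · refine integral_congr_ae (ae_of_all _ fun ρ => ?_)
    have hA : Continuous fun s => 𝓕 (Φ s) ρ :=
      h.continuous_fourier.comp (Continuous.prodMk_left ρ)
    simp only [mul_left_comm (cexp (-z * _))]
    rw [integral_const_mul, integral_Ioi_cexp_mul_duhamel hz _ hA (fun s => h.fourier_le s ρ),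
      h.fourier_laplace hz]
    have : z + I * ((a * ρ ^ 2 + 2 * b * ρ + c : ℝ) : ℂ) =
        I * (a * ρ ^ 2 + 2 * b * ρ + (c - I * z)) := by
      push_cast
      linear_combination z * I_sq
    rw [this, mul_inv, inv_I]
    ring
  · refine ((integrableOn_mul_cexp_neg_mul hz).mul_prod (h.integrable_affine_mul a b)).mono' ?_
      (ae_of_all _ fun q => ?_)
    · refine Continuous.aestronglyMeasurable ?_
      exact Continuous.mul (by fun_prop) (h.continuous_integrand a b c x)
    · rw [Function.uncurry, norm_mul, mul_comm |q.1|, mul_assoc ‖cexp (-z * q.1)‖]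
      exact mul_le_mul_of_nonneg_left (h.norm_integrand_le a b c x q.1 q.2)
        (norm_nonneg (cexp (-z * q.1)))

end HasFourierBounds

theorem fourier_indicator_Ioi_mul (δ : ℝ) (f : ℝ → ℂ) (τ : ℝ) :
    𝓕 ((Set.Ioi (0 : ℝ)).indicator fun t => cexp (-δ * t) * f t) τ =
      ∫ t in Set.Ioi (0 : ℝ), cexp (-(δ + 2 * Real.pi * τ * I) * t) * f t := by
  rw [Real.fourier_real_eq_integral_exp_smul, ← integral_indicator measurableSet_Ioi]
  refine integral_congr_ae (ae_of_all _ fun t => ?_)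
  simp only [Set.indicator_apply, smul_eq_mul]
  split_ifs
  · rw [← mul_assoc, ← Complex.exp_add]
    congr 2
    push_cast
    ring
  · simp

namespace HasFourierBounds

variable {Φ : ℝ → ℝ → ℂ} {M : ℝ} {B D : ℝ → ℝ}

theorem lintegral_laplace_sq_le (h : HasFourierBounds Φ M B D) {δ : ℝ} (hδ : 0 < δ) (r : ℝ) :
    ∫⁻ τ : ℝ, ‖∫ s in Set.Ioi (0 : ℝ), cexp (-(δ + 2 * Real.pi * τ * I) * s) * Φ s r‖ₑ ^ 2 ≤
      ∫⁻ s, ‖Φ s r‖ₑ ^ 2 := by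
  have hc : Continuous fun s => Φ s r := h.cont.comp (Continuous.prodMk_left r)
  simp_rw [← fourier_indicator_Ioi_mul δ (fun s => Φ s r)]
  refine (lintegral_enorm_fourier_sq_le ?_).trans (lintegral_mono fun s => ?_)
  · rw [integrable_indicator_iff measurableSet_Ioi]
    exact integrableOn_cexp_neg_mul_mul (z := δ) (by simpa using hδ) hc (fun s => h.bound s r)
  · simp only [Set.indicator_apply]
    split_ifs with hs
    · rw [enorm_mul]
      have : ‖cexp (-δ * s)‖ₑ ≤ 1 := by
        rw [← ofReal_norm, Complex.norm_exp]
        simp only [ENNReal.ofReal_le_one, Real.exp_le_one_iff]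
        simp only [mul_re, neg_re, neg_im, ofReal_re, ofReal_im, mul_zero, sub_zero]
        nlinarith [Set.mem_Ioi.1 hs]
      gcongr
      exact mul_le_of_le_one_left' this
    · simp

theorem lintegral_Ioi_damped_duhamelLine_sq_le (h : HasFourierBounds Φ M B D) (a b c x : ℝ)
    {δ : ℝ} (hδ : 0 < δ) :
    ∫⁻ t in Set.Ioi (0 : ℝ), ‖cexp (-δ * t) * duhamelLine a b c Φ t x‖ₑ ^ 2 ≤
      (ENNReal.ofReal (2 * Real.pi) * ∫⁻ r, (∫⁻ s, ‖Φ s r‖ₑ ^ 2) ^ (1 / 2 : ℝ)) ^ 2 := by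
  set K : ℝ := ∫ ρ, |a * ρ + b| * D ρ with hK
  have hδ' : 0 < (δ : ℂ).re := by simpa using hδ
  have hz : ∀ τ : ℝ, 0 < (δ + 2 * Real.pi * τ * I : ℂ).re := fun τ => by simpa using hδ
  set g : ℝ → ℂ := (Set.Ioi (0 : ℝ)).indicator fun t => cexp (-δ * t) * duhamelLine a b c Φ t x
    with hg
  have hgm : AEStronglyMeasurable g volume := by
    refine StronglyMeasurable.aestronglyMeasurable ?_
    refine StronglyMeasurable.indicator ?_ measurableSet_Ioi
    exact (Continuous.stronglyMeasurable (by fun_prop)).mul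
      (h.stronglyMeasurable_duhamelLine a b c x)
  have hgi : Integrable g := by
    have := (integrable_indicator_iff measurableSet_Ioi).2
      ((integrableOn_mul_cexp_neg_mul hδ').mul_const K)
    refine this.mono' hgm (ae_of_all _ fun t => ?_)
    simp only [hg, Set.indicator_apply]
    split_ifs
    · rw [norm_mul, mul_comm |t|, mul_assoc]
      exact mul_le_mul_of_nonneg_left (h.norm_duhamelLine_le a b c t x) (norm_nonneg _)
    · simp
  have hK0 : 0 ≤ K := integral_nonneg fun ρ => mul_nonneg (abs_nonneg _) (h.nonneg_right ρ)
  have hgb : ∀ t, ‖g t‖ ≤ δ⁻¹ * K := by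
    intro t
    simp only [hg, Set.indicator_apply]
    split_ifs with ht
    · have ht' : 0 < t := ht
      rw [norm_mul, Complex.norm_exp]
      simp only [mul_re, neg_re, neg_im, ofReal_re, ofReal_im, mul_zero, sub_zero]
      have h1 := h.norm_duhamelLine_le a b c t x
      have h2 : Real.exp (-δ * t) * t ≤ δ⁻¹ := by
        have h3 : δ * t ≤ Real.exp (δ * t) := by linarith [Real.add_one_le_exp (δ * t)]
        rw [neg_mul, Real.exp_neg, inv_mul_le_iff₀ (Real.exp_pos _), ← div_eq_mul_inv,
          le_div_iff₀ hδ]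
        linarith
      calc _ ≤ Real.exp (-δ * t) * (|t| * K) := by gcongr
        _ = (Real.exp (-δ * t) * t) * K := by rw [abs_of_pos ht']; ring
        _ ≤ _ := by gcongr
    · simp only [norm_zero]; positivity
  have hg2 : MemLp g 2 := by
    rw [memLp_two_iff_integrable_sq_norm hgm]
    have := hgi.norm.bdd_mul (c := δ⁻¹ * K) hgm.norm (ae_of_all _ fun t => by simpa using hgb t)
    exact this.congr (ae_of_all _ fun t => (sq _).symm)
  have hpt : ∀ τ : ℝ, ‖𝓕 g τ‖ₑ ≤ ENNReal.ofReal (2 * Real.pi) * ∫⁻ r,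
      ‖∫ s in Set.Ioi (0 : ℝ), cexp (-(δ + 2 * Real.pi * τ * I) * s) * Φ s r‖ₑ := by
    intro τ
    rw [hg, fourier_indicator_Ioi_mul, h.integral_Ioi_cexp_mul_duhamelLine a b c x (hz τ),
      enorm_mul]
    have : ‖-I‖ₑ = 1 := by rw [← ofReal_norm]; simp
    rw [this, one_mul]
    refine enorm_integral_exp_mul_logDeriv_mul_fourier_le a b ?_ x (h.continuous_laplace (hz τ))
      (h.integrable_laplace (hz τ)) (h.integrable_fourier_laplace (hz τ))
    simp [hδ.ne']
  have hmeas : Measurable (Function.uncurry fun τ r : ℝ =>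
      ‖∫ s in Set.Ioi (0 : ℝ), cexp (-(δ + 2 * Real.pi * τ * I) * s) * Φ s r‖ₑ) := by
    have : Continuous fun q : (ℝ × ℝ) × ℝ =>
        cexp (-(δ + 2 * Real.pi * q.1.1 * I) * q.2) * Φ q.2 q.1.2 :=
      Continuous.mul (by fun_prop)
        (h.cont.comp (continuous_snd.prodMk (continuous_snd.comp continuous_fst)))
    exact (this.stronglyMeasurable.integral_prod_right'
      (ν := volume.restrict (Set.Ioi (0 : ℝ)))).measurable.enorm
  calc _ = ∫⁻ t, ‖g t‖ₑ ^ 2 := by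
        rw [← lintegral_indicator measurableSet_Ioi]
        congr with t
        simp only [hg, Set.indicator_apply]
        split_ifs <;> simp
    _ = ∫⁻ τ, ‖𝓕 g τ‖ₑ ^ 2 := (lintegral_enorm_fourier_sq hgi hg2).symm
    _ ≤ ∫⁻ τ : ℝ, (ENNReal.ofReal (2 * Real.pi) * ∫⁻ r,
          ‖∫ s in Set.Ioi (0 : ℝ), cexp (-(δ + 2 * Real.pi * τ * I) * s) * Φ s r‖ₑ) ^ 2 := by
        gcongr with τ
        exact hpt τ
    _ = ENNReal.ofReal (2 * Real.pi) ^ 2 * ∫⁻ τ : ℝ, (∫⁻ r,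
          ‖∫ s in Set.Ioi (0 : ℝ), cexp (-(δ + 2 * Real.pi * τ * I) * s) * Φ s r‖ₑ) ^ 2 := by
        simp_rw [mul_pow]
        exact lintegral_const_mul' _ _ (ENNReal.pow_ne_top ENNReal.ofReal_ne_top)
    _ ≤ ENNReal.ofReal (2 * Real.pi) ^ 2 * (∫⁻ r, (∫⁻ τ : ℝ,
          ‖∫ s in Set.Ioi (0 : ℝ), cexp (-(δ + 2 * Real.pi * τ * I) * s) * Φ s r‖ₑ ^ 2)
            ^ (1 / 2 : ℝ)) ^ 2 := by
        gcongr
        exact lintegral_lintegral_sq_le volume volume hmeas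
    _ ≤ _ := by
        rw [mul_pow]
        refine mul_le_mul_right (pow_le_pow_left' (lintegral_mono fun r => ?_) 2) _
        exact ENNReal.rpow_le_rpow (h.lintegral_laplace_sq_le hδ r) (by norm_num)

theorem lintegral_Ioi_duhamelLine_sq_le (h : HasFourierBounds Φ M B D) (a b c x : ℝ) :
    ∫⁻ t in Set.Ioi (0 : ℝ), ‖duhamelLine a b c Φ t x‖ₑ ^ 2 ≤
      (ENNReal.ofReal (2 * Real.pi) * ∫⁻ r, (∫⁻ s, ‖Φ s r‖ₑ ^ 2) ^ (1 / 2 : ℝ)) ^ 2 := by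
  set δ : ℕ → ℝ := fun k => 1 / ((k : ℝ) + 1)
  have hδ : ∀ k, 0 < δ k := fun k => Nat.one_div_pos_of_nat
  have hlim : Tendsto δ atTop (𝓝 0) := tendsto_one_div_add_atTop_nhds_zero_nat
  have hmeas := (h.stronglyMeasurable_duhamelLine a b c x).measurable
  calc _ ≤ ∫⁻ t in Set.Ioi (0 : ℝ),
          liminf (fun k => ‖cexp (-δ k * t) * duhamelLine a b c Φ t x‖ₑ ^ 2) atTop := by
        refine lintegral_mono fun t => le_of_eq ?_
        refine (Tendsto.liminf_eq ?_).symm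
        refine ENNReal.Tendsto.pow (Tendsto.enorm ?_)
        have hcont : Continuous fun d : ℝ => cexp (-d * t) * duhamelLine a b c Φ t x := by
          fun_prop
        simpa [Function.comp_def] using (hcont.tendsto 0).comp hlim
    _ ≤ liminf (fun k => ∫⁻ t in Set.Ioi (0 : ℝ),
          ‖cexp (-δ k * t) * duhamelLine a b c Φ t x‖ₑ ^ 2) atTop :=
        lintegral_liminf_le fun k => by fun_prop
    _ ≤ _ := by
        refine liminf_le_of_le (by isBoundedDefault) fun y hy => ?_
        obtain ⟨k, hk⟩ := hy.exists
        exact hk.trans (h.lintegral_Ioi_damped_duhamelLine_sq_le a b c x (hδ k))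

theorem lintegral_duhamelLine_sq_le (h : HasFourierBounds Φ M B D) (a b c x : ℝ) :
    ∫⁻ t, ‖duhamelLine a b c Φ t x‖ₑ ^ 2 ≤
      2 * (ENNReal.ofReal (2 * Real.pi) * ∫⁻ r, (∫⁻ s, ‖Φ s r‖ₑ ^ 2) ^ (1 / 2 : ℝ)) ^ 2 := by
  have hrefl : ∀ t, ‖duhamelLine a b c Φ (-t) x‖ₑ =
      ‖duhamelLine (-a) (-b) (-c) (fun s => Φ (-s)) t x‖ₑ := by
    intro t
    congr 1
    unfold duhamelLine
    refine integral_congr_ae (ae_of_all _ fun ρ => ?_)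
    simp only
    have := intervalIntegral.integral_comp_neg (a := 0) (b := t)
      (fun s => cexp (-I * ((-t - s : ℝ) : ℂ) * ((a * ρ ^ 2 + 2 * b * ρ + c : ℝ) : ℂ)) *
        𝓕 (Φ s) ρ)
    rw [neg_zero, intervalIntegral.integral_symm (0 : ℝ) (-t)] at this
    rw [← neg_eq_iff_eq_neg.2 this]
    have h2 : ∀ s : ℝ,
        cexp (-I * ((-t - -s : ℝ) : ℂ) * ((a * ρ ^ 2 + 2 * b * ρ + c : ℝ) : ℂ)) =
        cexp (-I * ((t - s : ℝ) : ℂ) * ((-a * ρ ^ 2 + 2 * -b * ρ + -c : ℝ) : ℂ)) := by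
      intro s
      congr 1
      push_cast
      ring
    simp_rw [h2]
    push_cast
    ring
  have hneg : ∫⁻ t in Set.Iio (0 : ℝ), ‖duhamelLine a b c Φ t x‖ₑ ^ 2 =
      ∫⁻ t in Set.Ioi (0 : ℝ), ‖duhamelLine a b c Φ (-t) x‖ₑ ^ 2 := by
    have := (Measure.measurePreserving_neg (volume : Measure ℝ)).setLIntegral_comp_emb
      (MeasurableEquiv.neg ℝ).measurableEmbedding
      (fun t => ‖duhamelLine a b c Φ t x‖ₑ ^ 2) (Set.Ioi (0 : ℝ))
    rw [this]
    simp
  have hsplit : ∫⁻ t, ‖duhamelLine a b c Φ t x‖ₑ ^ 2 =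
      (∫⁻ t in Set.Iio (0 : ℝ), ‖duhamelLine a b c Φ t x‖ₑ ^ 2) +
        ∫⁻ t in Set.Ioi (0 : ℝ), ‖duhamelLine a b c Φ t x‖ₑ ^ 2 := by
    rw [← lintegral_add_compl _ (measurableSet_Iio (a := (0 : ℝ))), Set.compl_Iio,
      setLIntegral_congr Ioi_ae_eq_Ici]
  have hΦ : ∀ r, ∫⁻ s, ‖Φ (-s) r‖ₑ ^ 2 = ∫⁻ s, ‖Φ s r‖ₑ ^ 2 := fun r =>
    (Measure.measurePreserving_neg (volume : Measure ℝ)).lintegral_comp_emb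
      (MeasurableEquiv.neg ℝ).measurableEmbedding (fun s => ‖Φ s r‖ₑ ^ 2)
  have h1 := h.neg.lintegral_Ioi_duhamelLine_sq_le (-a) (-b) (-c) x
  simp_rw [hΦ, ← hrefl] at h1
  rw [hsplit, hneg, two_mul]
  exact add_le_add h1 (h.lintegral_Ioi_duhamelLine_sq_le a b c x)

end HasFourierBounds

theorem le_mul_one_add_rpow_neg {x y C : ℝ} (hx : 0 ≤ x) {N : ℕ} (h : (1 + x) ^ N * y ≤ C) :
    y ≤ C * (1 + x) ^ (-(N : ℝ)) := by
  have : 0 < 1 + x := by positivity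
  rw [Real.rpow_neg this.le, Real.rpow_natCast, ← div_eq_mul_inv, le_div_iff₀ (by positivity)]
  linarith

namespace SchwartzMap

section Slice

variable {E : Type*} [NormedAddCommGroup E] [NormedSpace ℝ E]

theorem contDiff_slice (F : SchwartzMap (ℝ × E) ℂ) (s : ℝ) (n : WithTop ℕ∞) (hn : n ≤ (⊤ : ℕ∞)) :
    ContDiff ℝ n (fun y => F (s, y)) :=
  ((F.smooth ⊤).of_le hn).comp (contDiff_const.prodMk contDiff_id)

theorem norm_iteratedFDeriv_slice_le (F : SchwartzMap (ℝ × E) ℂ) (k : ℕ) (s : ℝ) (y : E) :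
    ‖iteratedFDeriv ℝ k (fun y => F (s, y)) y‖ ≤ ‖iteratedFDeriv ℝ k F (s, y)‖ := by
  have h1 : (fun y => F (s, y)) =
      (fun z => F ((s, (0 : E)) + z)) ∘ (ContinuousLinearMap.inr ℝ ℝ E) := by
    ext y; simp
  have h2 : ContDiff ℝ k (fun z => F ((s, (0 : E)) + z)) :=
    (F.smooth k).comp (contDiff_const.add contDiff_id)
  rw [h1, ContinuousLinearMap.iteratedFDeriv_comp_right _ h2 y le_rfl,
    iteratedFDeriv_comp_add_left]
  refine (ContinuousMultilinearMap.norm_compContinuousLinearMap_le _ _).trans ?_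
  simp only [ContinuousLinearMap.inr_apply, Prod.mk_add_mk, add_zero, zero_add]
  refine mul_le_of_le_one_right (norm_nonneg _) ?_
  exact Finset.prod_le_one (fun _ _ => norm_nonneg _)
    (fun _ _ => ContinuousLinearMap.norm_inr_le_one ℝ ℝ E)

theorem exists_one_add_pow_mul_norm_iteratedFDeriv_slice_le (F : SchwartzMap (ℝ × E) ℂ)
    (N k : ℕ) :
    ∃ C, ∀ s y, (1 + ‖y‖) ^ N * ‖iteratedFDeriv ℝ k (fun y => F (s, y)) y‖ ≤ C := by
  refine ⟨_, fun s y => le_trans ?_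
    (one_add_le_sup_seminorm_apply (𝕜 := ℝ) (m := (N, k)) le_rfl le_rfl F (s, y))⟩
  gcongr
  · exact norm_snd_le (s, y)
  · exact F.norm_iteratedFDeriv_slice_le k s y

theorem exists_norm_slice_le (F : SchwartzMap (ℝ × E) ℂ) (N : ℕ) :
    ∃ C, 0 ≤ C ∧ ∀ s y, ‖F (s, y)‖ ≤ C * (1 + ‖y‖) ^ (-(N : ℝ)) := by
  obtain ⟨C, hC⟩ := F.exists_one_add_pow_mul_norm_iteratedFDeriv_slice_le N 0
  simp only [norm_iteratedFDeriv_zero] at hC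
  exact ⟨C, le_trans (by positivity) (hC 0 0), fun s y =>
    le_mul_one_add_rpow_neg (norm_nonneg y) (hC s y)⟩

end Slice

section FourierSlice

variable {E : Type*} [NormedAddCommGroup E] [InnerProductSpace ℝ E] [FiniteDimensional ℝ E]
  [MeasurableSpace E] [BorelSpace E]

theorem exists_integral_iteratedFDeriv_slice_le (F : SchwartzMap (ℝ × E) ℂ) (k : ℕ) :
    ∃ C, ∀ s, Integrable (fun y => ‖iteratedFDeriv ℝ k (fun y => F (s, y)) y‖) ∧
      ∫ y, ‖iteratedFDeriv ℝ k (fun y => F (s, y)) y‖ ≤ C := by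
  obtain ⟨C, hC⟩ := F.exists_one_add_pow_mul_norm_iteratedFDeriv_slice_le
    (Module.finrank ℝ E + 1) k
  have hi : Integrable (fun y : E => C * (1 + ‖y‖) ^ (-((Module.finrank ℝ E + 1 : ℕ) : ℝ))) :=
    (integrable_one_add_norm (by push_cast; linarith)).const_mul C
  have hle : ∀ s y, ‖iteratedFDeriv ℝ k (fun y => F (s, y)) y‖ ≤
      C * (1 + ‖y‖) ^ (-((Module.finrank ℝ E + 1 : ℕ) : ℝ)) := fun s y =>
    le_mul_one_add_rpow_neg (norm_nonneg y) (hC s y)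
  have hi2 : ∀ s, Integrable (fun y => ‖iteratedFDeriv ℝ k (fun y => F (s, y)) y‖) := fun s =>
    hi.mono' ((F.contDiff_slice s k (by exact_mod_cast le_top)).continuous_iteratedFDeriv
      le_rfl).norm.aestronglyMeasurable (ae_of_all _ fun y => by simpa using hle s y)
  exact ⟨_, fun s => ⟨hi2 s, integral_mono (hi2 s) hi (hle s)⟩⟩

theorem exists_norm_fourier_slice_le (F : SchwartzMap (ℝ × E) ℂ) (N : ℕ) :
    ∃ C, 0 ≤ C ∧ ∀ s ξ, ‖𝓕 (fun y => F (s, y)) ξ‖ ≤ C * (1 + ‖ξ‖) ^ (-(N : ℝ)) := by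
  choose C hC using F.exists_integral_iteratedFDeriv_slice_le
  have key : ∀ n : ℕ, ∃ K, ∀ s ξ, ‖ξ‖ ^ n * ‖𝓕 (fun y => F (s, y)) ξ‖ ≤ K := by
    intro n
    refine ⟨2 ^ n * ∑ p ∈ Finset.range (0 + 1) ×ˢ Finset.range (n + 1), C p.2, fun s ξ => ?_⟩
    have := Real.pow_mul_norm_iteratedFDeriv_fourier_le (K := 0) (N := ⊤)
      (F.contDiff_slice s _ le_rfl) (fun k j hk _ => by
        have hk0 : k = 0 := by simpa using hk
        simpa [hk0] using (hC j s).1) (k := 0) (n := n) le_rfl le_top ξ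
    simp only [norm_iteratedFDeriv_zero, pow_zero, one_mul, CharP.cast_eq_zero, mul_zero,
      zero_add] at this
    refine this.trans ?_
    gcongr with p hp
    have hp0 : p.1 = 0 := by simpa using (Finset.mem_product.1 hp).1
    simpa [hp0] using (hC p.2 s).2
  obtain ⟨K₀, h₀⟩ := key 0
  obtain ⟨K, hK⟩ := key N
  have hpow : ∀ s ξ, (1 + ‖ξ‖) ^ N * ‖𝓕 (fun y => F (s, y)) ξ‖ ≤ 2 ^ (N - 1) * (K₀ + K) := by
    intro s ξ
    have h1 := add_pow_le (zero_le_one (α := ℝ)) (norm_nonneg ξ) N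
    have h2 := h₀ s ξ
    have h3 := hK s ξ
    calc _ ≤ 2 ^ (N - 1) * (1 ^ N + ‖ξ‖ ^ N) * ‖𝓕 (fun y => F (s, y)) ξ‖ := by gcongr
      _ = 2 ^ (N - 1) * (‖ξ‖ ^ 0 * ‖𝓕 (fun y => F (s, y)) ξ‖ +
            ‖ξ‖ ^ N * ‖𝓕 (fun y => F (s, y)) ξ‖) := by
          rw [one_pow, pow_zero]; ring
      _ ≤ _ := by gcongr
  exact ⟨_, le_trans (by positivity) (hpow 0 0), fun s ξ =>
    le_mul_one_add_rpow_neg (norm_nonneg ξ) (hpow s ξ)⟩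

theorem integrable_slice (F : SchwartzMap (ℝ × E) ℂ) (s : ℝ) : Integrable (fun y => F (s, y)) := by
  obtain ⟨C, hC⟩ := F.exists_integral_iteratedFDeriv_slice_le 0
  have := (hC s).1
  simp only [norm_iteratedFDeriv_zero] at this
  exact (integrable_norm_iff (F.contDiff_slice s 0 zero_le).continuous.aestronglyMeasurable).1 this

theorem continuous_fourier_slice (F : SchwartzMap (ℝ × E) ℂ) :
    Continuous (fun p : ℝ × E => 𝓕 (fun y => F (p.1, y)) p.2) := by
  obtain ⟨C, -, hC⟩ := F.exists_norm_slice_le (Module.finrank ℝ E + 1)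
  have hF := F.continuous
  simp_rw [Real.fourier_eq']
  refine continuous_of_dominated
    (bound := fun y : E => C * (1 + ‖y‖) ^ (-((Module.finrank ℝ E + 1 : ℕ) : ℝ)))
    (fun p => Continuous.aestronglyMeasurable (by fun_prop)) (fun p => ae_of_all _ fun y => ?_)
    ((integrable_one_add_norm (by push_cast; linarith)).const_mul C) (ae_of_all _ fun y => ?_)
  · rw [norm_smul, norm_exp_ofReal_mul_I, one_mul]
    exact hC _ _
  · fun_prop

end FourierSlice

end SchwartzMap

section Hyperplane

variable {E : Type*} [NormedAddCommGroup E] [InnerProductSpace ℝ E] {e : E} {K : Submodule ℝ E}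

theorem inner_smul_add_smul_add (he : ‖e‖ = 1) (hK : K = (ℝ ∙ e)ᗮ) (ρ r : ℝ) (η v : K) :
    ⟪ρ • e + (η : E), r • e + (v : E)⟫ = ρ * r + ⟪η, v⟫ := by
  have h : ∀ w : K, ⟪e, (w : E)⟫ = 0 := fun w =>
    Submodule.mem_orthogonal_singleton_iff_inner_right.1 (hK ▸ w.2)
  have h' : ∀ w : K, ⟪(w : E), e⟫ = 0 := fun w => by rw [real_inner_comm, h]
  simp [inner_add_left, inner_add_right, inner_smul_left, inner_smul_right, h, h', he, mul_comm]

theorem norm_sq_smul_add (he : ‖e‖ = 1) (hK : K = (ℝ ∙ e)ᗮ) (ρ : ℝ) (η : K) :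
    ‖ρ • e + (η : E)‖ ^ 2 = ρ ^ 2 + ‖η‖ ^ 2 := by
  rw [← real_inner_self_eq_norm_sq, inner_smul_add_smul_add he hK, real_inner_self_eq_norm_sq, sq ρ]

theorem abs_le_norm_smul_add (he : ‖e‖ = 1) (hK : K = (ℝ ∙ e)ᗮ) (ρ : ℝ) (η : K) :
    |ρ| ≤ ‖ρ • e + (η : E)‖ := by
  refine abs_le_of_sq_le_sq ?_ (norm_nonneg _)
  rw [norm_sq_smul_add he hK]; linarith [sq_nonneg ‖η‖]

theorem norm_le_norm_smul_add (he : ‖e‖ = 1) (hK : K = (ℝ ∙ e)ᗮ) (ρ : ℝ) (η : K) :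
    ‖η‖ ≤ ‖ρ • e + (η : E)‖ := by
  refine le_of_sq_le_sq ?_ (norm_nonneg _)
  rw [norm_sq_smul_add he hK]; linarith [sq_nonneg ρ]

/-- Orthogonal coordinates `(ρ, η) ↦ ρe + η` adapted to a unit vector `e`. -/
def orthogonalCoordinates (he : ‖e‖ = 1) (hK : K = (ℝ ∙ e)ᗮ) : WithLp 2 (ℝ × K) ≃ₗᵢ[ℝ] E :=
  LinearIsometryEquiv.ofSurjective
    { toFun := fun p => p.fst • e + (p.snd : E)
      map_add' := fun p q => by
        simp only [WithLp.add_fst, WithLp.add_snd, add_smul, Submodule.coe_add]; abel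
      map_smul' := fun c p => by simp [smul_smul]
      norm_map' := fun p => by
        have h := WithLp.prod_norm_sq_eq_of_L2 p
        rw [Real.norm_eq_abs, sq_abs, ← norm_sq_smul_add he hK] at h
        exact ((sq_eq_sq₀ (norm_nonneg _) (norm_nonneg _)).1 h).symm }
    (fun x => by
      have hx : x - ⟪e, x⟫ • e ∈ K := by
        rw [hK, Submodule.mem_orthogonal_singleton_iff_inner_right]
        simp [inner_sub_right, inner_smul_right, he]
      exact ⟨WithLp.toLp 2 (⟪e, x⟫, ⟨_, hx⟩), add_sub_cancel _ _⟩)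

variable [FiniteDimensional ℝ E] [MeasurableSpace E] [BorelSpace E]

theorem measurePreserving_smul_add (he : ‖e‖ = 1) (hK : K = (ℝ ∙ e)ᗮ) :
    MeasurePreserving (fun p : ℝ × K => p.1 • e + (p.2 : E)) :=
  (orthogonalCoordinates he hK).measurePreserving.comp
    (WithLp.volume_preserving_symm_measurableEquiv_toLp_prod ℝ K).symm

theorem measurableEmbedding_smul_add (he : ‖e‖ = 1) (hK : K = (ℝ ∙ e)ᗮ) :
    MeasurableEmbedding (fun p : ℝ × K => p.1 • e + (p.2 : E)) :=
  (orthogonalCoordinates he hK).toHomeomorph.measurableEmbedding.comp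
    (MeasurableEquiv.toLp 2 (ℝ × K)).measurableEmbedding

end Hyperplane

namespace SchwartzMap

theorem exists_norm_smul_add_le {E : Type*} [NormedAddCommGroup E] [InnerProductSpace ℝ E] {e : E}
    {K : Submodule ℝ E} (F : SchwartzMap (ℝ × E) ℂ) (he : ‖e‖ = 1) (hK : K = (ℝ ∙ e)ᗮ) :
    ∃ C, 0 ≤ C ∧ ∀ (s r : ℝ) (v : K), ‖F (s, r • e + (v : E))‖ ≤
      C * (1 + ‖r‖) ^ (-2 : ℝ) * (1 + ‖v‖) ^ (-((Module.finrank ℝ K + 1 : ℕ) : ℝ)) := by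
  obtain ⟨C, hC0, hC⟩ := F.exists_norm_slice_le (2 + (Module.finrank ℝ K + 1))
  refine ⟨C, hC0, fun s r v => (hC _ _).trans ?_⟩
  have hpos : 0 < 1 + ‖r • e + (v : E)‖ := by positivity
  have h1 : (-((2 + (Module.finrank ℝ K + 1) : ℕ) : ℝ)) =
      -2 + -((Module.finrank ℝ K + 1 : ℕ) : ℝ) := by push_cast; ring
  rw [h1, Real.rpow_add hpos, mul_assoc]
  refine mul_le_mul_of_nonneg_left ?_ hC0
  refine mul_le_mul ?_ ?_ (by positivity) (by positivity)
  · refine Real.rpow_le_rpow_of_nonpos (by positivity) ?_ (by norm_num)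
    gcongr
    exact abs_le_norm_smul_add he hK r v
  · refine Real.rpow_le_rpow_of_nonpos (by positivity) ?_ (neg_nonpos.2 (Nat.cast_nonneg _))
    gcongr
    exact norm_le_norm_smul_add he hK r v

section Transverse

variable {E : Type*} [NormedAddCommGroup E] [InnerProductSpace ℝ E] [FiniteDimensional ℝ E]
  [MeasurableSpace E] [BorelSpace E] {e : E} {K : Submodule ℝ E}

/-- The Fourier transform of `F(s, re + ·)` along the subspace `K`. -/
def transverseFourier (F : SchwartzMap (ℝ × E) ℂ) (e : E) (K : Submodule ℝ E) (η : K) (s r : ℝ) :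
    ℂ :=
  𝓕 (fun v : K => F (s, r • e + (v : E))) η

theorem integrable_smul_add (F : SchwartzMap (ℝ × E) ℂ) (he : ‖e‖ = 1) (hK : K = (ℝ ∙ e)ᗮ)
    (s r : ℝ) : Integrable (fun v : K => F (s, r • e + (v : E))) := by
  obtain ⟨C, hC0, hC⟩ := F.exists_norm_smul_add_le he hK
  have hF := F.continuous
  exact ((integrable_one_add_norm (by push_cast; linarith)).const_mul _).mono'
    (Continuous.aestronglyMeasurable (by fun_prop)) (ae_of_all _ (hC s r))

theorem continuous_transverseFourier (F : SchwartzMap (ℝ × E) ℂ) (he : ‖e‖ = 1)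
    (hK : K = (ℝ ∙ e)ᗮ) :
    Continuous (fun p : K × ℝ × ℝ => F.transverseFourier e K p.1 p.2.1 p.2.2) := by
  obtain ⟨C, hC0, hC⟩ := F.exists_norm_smul_add_le he hK
  have hF := F.continuous
  simp_rw [transverseFourier, Real.fourier_eq']
  refine continuous_of_dominated
    (bound := fun v : K => C * (1 + ‖v‖) ^ (-((Module.finrank ℝ K + 1 : ℕ) : ℝ)))
    (fun p => Continuous.aestronglyMeasurable (by fun_prop)) (fun p => ae_of_all _ fun v => ?_)
    ((integrable_one_add_norm (by push_cast; linarith)).const_mul C) (ae_of_all _ fun v => ?_)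
  · rw [norm_smul, norm_exp_ofReal_mul_I, one_mul]
    refine (hC _ _ _).trans ?_
    gcongr
    refine mul_le_of_le_one_right hC0 ?_
    exact Real.rpow_le_one_of_one_le_of_nonpos (by simp) (by norm_num)
  · fun_prop

theorem fourier_transverseFourier (F : SchwartzMap (ℝ × E) ℂ) (he : ‖e‖ = 1)
    (hK : K = (ℝ ∙ e)ᗮ) (η : K) (s ρ : ℝ) :
    𝓕 (F.transverseFourier e K η s) ρ = 𝓕 (fun y => F (s, y)) (ρ • e + (η : E)) := by
  have hmp := measurePreserving_smul_add he hK
  have hme := measurableEmbedding_smul_add he hK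
  have hF := F.continuous
  have hint : Integrable (fun y : E => cexp (↑(-2 * Real.pi * ⟪y, ρ • e + (η : E)⟫) * I) •
      F (s, y)) := by
    refine (F.integrable_slice s).norm.mono' (Continuous.aestronglyMeasurable (by fun_prop))
      (ae_of_all _ fun y => ?_)
    rw [norm_smul, norm_exp_ofReal_mul_I, one_mul]
  rw [Real.fourier_real_eq_integral_exp_smul, Real.fourier_eq', ← hmp.integral_comp hme]
  have hint' := (hmp.integrable_comp_emb hme).2 hint
  rw [Measure.volume_eq_prod] at hint' ⊢
  refine Eq.trans ?_ (integral_prod _ hint').symm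
  refine integral_congr_ae (ae_of_all _ fun r => ?_)
  simp only [transverseFourier, Real.fourier_eq', Function.comp_apply, smul_eq_mul, ← integral_const_mul,
    inner_smul_add_smul_add he hK]
  refine integral_congr_ae (ae_of_all _ fun v => ?_)
  simp only
  rw [← mul_assoc, ← Complex.exp_add]
  congr 2
  push_cast
  ring

theorem exists_hasFourierBounds_transverseFourier (F : SchwartzMap (ℝ × E) ℂ) (he : ‖e‖ = 1)
    (hK : K = (ℝ ∙ e)ᗮ) :
    ∃ M B D, ∀ η : K, HasFourierBounds (F.transverseFourier e K η) M B D := by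
  obtain ⟨C, hC0, hC⟩ := F.exists_norm_smul_add_le he hK
  obtain ⟨C', hC'0, hC'⟩ := F.exists_norm_fourier_slice_le 3
  set J := ∫ v : K, (1 + ‖v‖) ^ (-((Module.finrank ℝ K + 1 : ℕ) : ℝ)) with hJ
  have hJ0 : 0 ≤ J := integral_nonneg fun v => by positivity
  have hB : ∀ (η : K) s r, ‖F.transverseFourier e K η s r‖ ≤ C * J * (1 + ‖r‖) ^ (-2 : ℝ) := by
    intro η s r
    rw [transverseFourier, Real.fourier_eq']
    have hi : Integrable (fun v : K => C * (1 + ‖r‖) ^ (-2 : ℝ) *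
        (1 + ‖v‖) ^ (-((Module.finrank ℝ K + 1 : ℕ) : ℝ))) :=
      (integrable_one_add_norm (by push_cast; linarith)).const_mul _
    refine (norm_integral_le_of_norm_le hi (ae_of_all _ fun v => ?_)).trans (le_of_eq ?_)
    · rw [norm_smul, norm_exp_ofReal_mul_I, one_mul]
      exact hC s r v
    · rw [integral_const_mul]; ring
  have hD : ∀ (η : K) s ρ, ‖𝓕 (F.transverseFourier e K η s) ρ‖ ≤ C' * (1 + ‖ρ‖) ^ (-3 : ℝ) := by
    intro η s ρ
    rw [F.fourier_transverseFourier he hK]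
    refine (hC' _ _).trans (mul_le_mul_of_nonneg_left ?_ hC'0)
    push_cast
    refine Real.rpow_le_rpow_of_nonpos (by positivity) ?_ (by norm_num)
    gcongr
    exact abs_le_norm_smul_add he hK ρ η
  have hi2 : Integrable (fun ρ : ℝ => (1 + ‖ρ‖) ^ (-2 : ℝ)) :=
    integrable_one_add_norm (by simp)
  have hi3 : Integrable (fun ρ : ℝ => (1 + ‖ρ‖) ^ (-3 : ℝ)) :=
    integrable_one_add_norm (by simp)
  refine ⟨C * J, fun r => C * J * (1 + ‖r‖) ^ (-2 : ℝ), fun ρ => C' * (1 + ‖ρ‖) ^ (-3 : ℝ),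
    fun η => ⟨?_, fun s r => ?_, hi2.const_mul _, hB η, hi3.const_mul _, ?_, hD η⟩⟩
  · have := (F.continuous_transverseFourier he hK).comp
      (f := fun p : ℝ × ℝ => (η, p)) (by fun_prop)
    exact this
  · refine (hB η s r).trans (mul_le_of_le_one_right (by positivity) ?_)
    exact Real.rpow_le_one_of_one_le_of_nonpos (by simp) (by norm_num)
  · refine (hi2.const_mul C').mono' ?_ (ae_of_all _ fun ρ => ?_)
    · exact (continuous_abs.aestronglyMeasurable (μ := volume)).mul
        (hi3.const_mul C').aestronglyMeasurable
    · have hpos : 0 < 1 + ‖ρ‖ := by positivity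
      rw [norm_mul, Real.norm_eq_abs |ρ|, abs_abs, Real.norm_of_nonneg (by positivity),
        mul_left_comm]
      refine mul_le_mul_of_nonneg_left ?_ hC'0
      have : (-2 : ℝ) = 1 + -3 := by norm_num
      rw [this, Real.rpow_add hpos, Real.rpow_one]
      gcongr
      simp

end Transverse

section DuhamelSymbol

variable {E : Type*} [NormedAddCommGroup E] [InnerProductSpace ℝ E] [FiniteDimensional ℝ E]
  [MeasurableSpace E] [BorelSpace E] {e : E} {K : Submodule ℝ E} {q : E → ℝ}

/-- The spatial Fourier transform at time `t` of the Duhamel integral for the symbol `q`. -/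
def duhamelSymbol (q : E → ℝ) (F : SchwartzMap (ℝ × E) ℂ) (t : ℝ) (ξ : E) : ℂ :=
  ∫ s in (0 : ℝ)..t, cexp (-I * ((t - s : ℝ) : ℂ) * q ξ) * 𝓕 (fun y => F (s, y)) ξ

theorem continuous_duhamelSymbol (F : SchwartzMap (ℝ × E) ℂ) (hq : Continuous q) :
    Continuous (fun p : ℝ × E => F.duhamelSymbol q p.1 p.2) := by
  refine intervalIntegral.continuous_parametric_intervalIntegral_of_continuous
    (f := fun (p : ℝ × E) s => cexp (-I * ((p.1 - s : ℝ) : ℂ) * q p.2) *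
      𝓕 (fun y => F (s, y)) p.2) ?_ continuous_fst
  have : Continuous fun x : (ℝ × E) × ℝ => 𝓕 (fun y => F (x.2, y)) x.1.2 :=
    F.continuous_fourier_slice.comp (continuous_snd.prodMk (continuous_snd.comp continuous_fst))
  unfold Function.uncurry
  fun_prop

theorem exists_norm_duhamelSymbol_le (q : E → ℝ) (F : SchwartzMap (ℝ × E) ℂ) (N : ℕ) :
    ∃ C, 0 ≤ C ∧ ∀ t ξ, ‖F.duhamelSymbol q t ξ‖ ≤ |t| * (C * (1 + ‖ξ‖) ^ (-(N : ℝ))) := by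
  obtain ⟨C, hC0, hC⟩ := F.exists_norm_fourier_slice_le N
  refine ⟨C, hC0, fun t ξ => ?_⟩
  have := intervalIntegral.norm_integral_le_of_norm_le_const (a := 0) (b := t)
    (C := C * (1 + ‖ξ‖) ^ (-(N : ℝ)))
    (f := fun s => cexp (-I * ((t - s : ℝ) : ℂ) * q ξ) * 𝓕 (fun y => F (s, y)) ξ) (fun s _ => by
      rw [norm_mul, norm_cexp_neg_I_mul_mul, one_mul]
      exact hC s ξ)
  simpa [duhamelSymbol, mul_comm] using this

theorem integrable_duhamelSymbol (F : SchwartzMap (ℝ × E) ℂ) (hq : Continuous q) (t : ℝ) :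
    Integrable (F.duhamelSymbol q t) := by
  obtain ⟨C, -, hC⟩ := F.exists_norm_duhamelSymbol_le q (Module.finrank ℝ E + 1)
  exact (((integrable_one_add_norm (by push_cast; linarith)).const_mul C).const_mul |t|).mono'
    ((F.continuous_duhamelSymbol hq).comp (Continuous.prodMk_right t)).aestronglyMeasurable
    (ae_of_all _ (hC t))

theorem integrable_inner_mul_duhamelSymbol (F : SchwartzMap (ℝ × E) ℂ) (hq : Continuous q)
    (e' : E) (t : ℝ) : Integrable (fun ξ => (⟪ξ, e'⟫ : ℂ) * F.duhamelSymbol q t ξ) := by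
  obtain ⟨C, hC0, hC⟩ := F.exists_norm_duhamelSymbol_le q (Module.finrank ℝ E + 2)
  have hi : Integrable (fun ξ : E => (1 + ‖ξ‖) ^ (-((Module.finrank ℝ E : ℝ) + 1))) :=
    integrable_one_add_norm (by linarith)
  have hc : Continuous fun ξ => F.duhamelSymbol q t ξ :=
    (F.continuous_duhamelSymbol hq).comp (Continuous.prodMk_right t)
  refine (hi.const_mul (‖e'‖ * |t| * C)).mono' (Continuous.aestronglyMeasurable (by fun_prop))
    (ae_of_all _ fun ξ => ?_)
  have hpos : 0 < 1 + ‖ξ‖ := by positivity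
  have h1 : ‖(⟪ξ, e'⟫ : ℂ)‖ ≤ (1 + ‖ξ‖) * ‖e'‖ := by
    rw [Complex.norm_real]
    refine (norm_inner_le_norm ξ e').trans ?_
    gcongr
    linarith
  have h2 : (1 + ‖ξ‖) ^ (-((Module.finrank ℝ E : ℝ) + 1)) =
      (1 + ‖ξ‖) * (1 + ‖ξ‖) ^ (-((Module.finrank ℝ E + 2 : ℕ) : ℝ)) := by
    nth_rewrite 2 [← Real.rpow_one (1 + ‖ξ‖)]
    rw [← Real.rpow_add hpos]
    congr 1
    push_cast
    ring
  rw [norm_mul, h2]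
  refine (mul_le_mul h1 (hC t ξ) (norm_nonneg _) (by positivity)).trans (le_of_eq ?_)
  ring

/-- Fubini in the orthogonal coordinates `ξ = ρe + η`, with the phase in `v` kept outside. -/
theorem fourierInv_smul_add {f : E → ℂ} (hf : Integrable f) (he : ‖e‖ = 1) (hK : K = (ℝ ∙ e)ᗮ)
    (r : ℝ) :
    Integrable (fun η : K => ∫ ρ : ℝ, cexp (2 * Real.pi * r * ρ * I) * f (ρ • e + (η : E))) ∧
    ∀ v : K, 𝓕⁻ f (r • e + (v : E)) =
      𝓕⁻ (fun η : K => ∫ ρ : ℝ, cexp (2 * Real.pi * r * ρ * I) * f (ρ • e + (η : E))) v := by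
  have hmp := measurePreserving_smul_add he hK
  have hme := measurableEmbedding_smul_add he hK
  have hf' := (hmp.integrable_comp_emb hme).2 hf
  rw [Measure.volume_eq_prod] at hf'
  have hi : Integrable (fun p : ℝ × K =>
      cexp (2 * Real.pi * r * p.1 * I) * f (p.1 • e + (p.2 : E)))
      ((volume : Measure ℝ).prod (volume : Measure K)) := by
    refine hf'.bdd_mul (c := 1) (Continuous.aestronglyMeasurable (by fun_prop))
      (ae_of_all _ fun p => ?_)
    have := norm_exp_ofReal_mul_I (2 * Real.pi * r * p.1)
    exact le_of_eq (by simpa using this)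
  refine ⟨hi.integral_prod_right, fun v => ?_⟩
  have hi' : Integrable (fun p : ℝ × K => cexp (↑(2 * Real.pi * ⟪p.2, v⟫) * I) *
      (cexp (2 * Real.pi * r * p.1 * I) * f (p.1 • e + (p.2 : E))))
      ((volume : Measure ℝ).prod (volume : Measure K)) := by
    refine hi.bdd_mul (c := 1) (Continuous.aestronglyMeasurable (by fun_prop))
      (ae_of_all _ fun p => ?_)
    exact (norm_exp_ofReal_mul_I _).le
  rw [Real.fourierInv_eq', Real.fourierInv_eq', ← hmp.integral_comp hme, Measure.volume_eq_prod]
  simp_rw [smul_eq_mul, ← integral_const_mul]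
  rw [← integral_prod_symm _ hi']
  refine integral_congr_ae (ae_of_all _ fun p => ?_)
  simp only
  rw [inner_smul_add_smul_add he hK, ← mul_assoc, ← Complex.exp_add]
  congr 2
  push_cast
  ring

theorem lintegral_fourierInv_duhamelSymbol_sq_le (F : SchwartzMap (ℝ × E) ℂ) (he : ‖e‖ = 1)
    (hK : K = (ℝ ∙ e)ᗮ) (hq : Continuous q) {e' : E} {a : ℝ} {b c : K → ℝ}
    (hqe : ∀ ρ (η : K), q (ρ • e + (η : E)) = a * ρ ^ 2 + 2 * b η * ρ + c η)
    (hm : ∀ ρ (η : K), ⟪ρ • e + (η : E), e'⟫ = a * ρ + b η) (x : ℝ) :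
    ∫⁻ t, ∫⁻ v : K,
        ‖𝓕⁻ (fun ξ => (⟪ξ, e'⟫ : ℂ) * F.duhamelSymbol q t ξ) (x • e + (v : E))‖ₑ ^ 2 ≤
      2 * (ENNReal.ofReal (2 * Real.pi) *
        ∫⁻ r : ℝ, (∫⁻ s, ∫⁻ v : K, ‖F (s, r • e + (v : E))‖ₑ ^ 2) ^ (1 / 2 : ℝ)) ^ 2 := by
  obtain ⟨M, B, D, hΦ⟩ := F.exists_hasFourierBounds_transverseFourier he hK
  set H : ℝ → K → ℂ := fun t η => ∫ ρ : ℝ, cexp (2 * Real.pi * x * ρ * I) *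
    ((⟪ρ • e + (η : E), e'⟫ : ℂ) * F.duhamelSymbol q t (ρ • e + (η : E))) with hH
  have hHline : ∀ t η, H t η = duhamelLine a (b η) (c η) (F.transverseFourier e K η) t x := by
    intro t η
    refine integral_congr_ae (ae_of_all _ fun ρ => ?_)
    simp only [F.fourier_transverseFourier he hK, duhamelSymbol, hqe, hm]
    push_cast
    ring
  have hHmeas : Measurable (Function.uncurry H) := by
    have h1 : Continuous fun p : (ℝ × K) × ℝ =>
        F.duhamelSymbol q p.1.1 (p.2 • e + (p.1.2 : E)) :=
      (F.continuous_duhamelSymbol hq).comp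
        (f := fun p : (ℝ × K) × ℝ => (p.1.1, p.2 • e + (p.1.2 : E))) (by fun_prop)
    have h2 : Continuous fun p : (ℝ × K) × ℝ => cexp (2 * Real.pi * x * p.2 * I) *
        ((⟪p.2 • e + (p.1.2 : E), e'⟫ : ℂ) *
          F.duhamelSymbol q p.1.1 (p.2 • e + (p.1.2 : E))) := by
      fun_prop
    exact (h2.stronglyMeasurable.integral_prod_right' (ν := (volume : Measure ℝ))).measurable
  have hΦc : Continuous (fun p : K × ℝ × ℝ => F.transverseFourier e K p.1 p.2.1 p.2.2) :=
    F.continuous_transverseFourier he hK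
  have hsq : ∀ y : ℝ≥0∞, (y ^ (1 / 2 : ℝ)) ^ 2 = y := fun y => by
    rw [← ENNReal.rpow_natCast, ← ENNReal.rpow_mul]; norm_num
  have hmeas : Measurable (Function.uncurry fun (η : K) (r : ℝ) =>
      (∫⁻ s, ‖F.transverseFourier e K η s r‖ₑ ^ 2) ^ (1 / 2 : ℝ)) := by
    have h1 : Measurable fun p : (K × ℝ) × ℝ => ‖F.transverseFourier e K p.1.1 p.2 p.1.2‖ₑ ^ 2 :=
      ((hΦc.comp (f := fun p : (K × ℝ) × ℝ => (p.1.1, p.2, p.1.2))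
        (by fun_prop)).measurable.enorm).pow_const 2
    exact h1.lintegral_prod_right'.pow_const _
  calc _ ≤ ∫⁻ t, ∫⁻ η, ‖H t η‖ₑ ^ 2 := by
        refine lintegral_mono fun t => ?_
        obtain ⟨h1, h2⟩ := fourierInv_smul_add (F.integrable_inner_mul_duhamelSymbol hq e' t)
          he hK x
        simp_rw [h2]
        exact lintegral_enorm_fourierInv_sq_le h1
    _ = ∫⁻ η, ∫⁻ t, ‖H t η‖ₑ ^ 2 :=
        lintegral_lintegral_swap (hHmeas.enorm.pow_const 2).aemeasurable
    _ ≤ ∫⁻ η, 2 * (ENNReal.ofReal (2 * Real.pi) *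
          ∫⁻ r, (∫⁻ s, ‖F.transverseFourier e K η s r‖ₑ ^ 2) ^ (1 / 2 : ℝ)) ^ 2 := by
        refine lintegral_mono fun η => ?_
        simp_rw [hHline]
        exact (hΦ η).lintegral_duhamelLine_sq_le a (b η) (c η) x
    _ = 2 * (ENNReal.ofReal (2 * Real.pi) ^ 2 * ∫⁻ η,
          (∫⁻ r, (∫⁻ s, ‖F.transverseFourier e K η s r‖ₑ ^ 2) ^ (1 / 2 : ℝ)) ^ 2) := by
        simp_rw [mul_pow]
        rw [lintegral_const_mul' _ _ (by simp),
          lintegral_const_mul' _ _ (ENNReal.pow_ne_top ENNReal.ofReal_ne_top)]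
    _ ≤ 2 * (ENNReal.ofReal (2 * Real.pi) ^ 2 *
          (∫⁻ r, (∫⁻ η, ∫⁻ s, ‖F.transverseFourier e K η s r‖ₑ ^ 2) ^ (1 / 2 : ℝ)) ^ 2) := by
        have := lintegral_lintegral_sq_le (volume : Measure K) (volume : Measure ℝ) hmeas
        simp only [hsq] at this
        gcongr
    _ ≤ _ := by
        rw [mul_pow]
        refine mul_le_mul_right (mul_le_mul_right
          (pow_le_pow_left' (lintegral_mono fun r => ENNReal.rpow_le_rpow ?_ (by norm_num)) 2) _) _
        rw [lintegral_lintegral_swap]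
        · refine lintegral_mono fun s => ?_
          exact lintegral_enorm_fourier_sq_le (F.integrable_smul_add he hK s r)
        · exact ((hΦc.comp (f := fun p : K × ℝ => (p.1, p.2, r))
            (by fun_prop)).measurable.enorm.pow_const 2).aemeasurable

end DuhamelSymbol

end SchwartzMap

theorem quadSym_smul_add {n : ℕ} (ε : Fin n → ℝ) (e η : Eucl n) (ρ : ℝ) :
    quadSym ε (ρ • e + η) = quadSym ε e * ρ ^ 2 + 2 * ⟪η, epm ε e⟫ * ρ + quadSym ε η := by
  simp only [quadSym, epm, PiLp.inner_apply, Finset.sum_mul, Finset.mul_sum,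
    ← Finset.sum_add_distrib]
  refine Finset.sum_congr rfl fun i _ => ?_
  simp
  ring

theorem inner_smul_add_epm {n : ℕ} (ε : Fin n → ℝ) (e η : Eucl n) (ρ : ℝ) :
    ⟪ρ • e + η, epm ε e⟫ = quadSym ε e * ρ + ⟪η, epm ε e⟫ := by
  rw [inner_add_left, real_inner_smul_left, mul_comm]
  congr 2
  simp only [quadSym, epm, PiLp.inner_apply]
  refine Finset.sum_congr rfl fun i _ => ?_
  simp
  ring

theorem continuous_quadSym {n : ℕ} (ε : Fin n → ℝ) : Continuous (quadSym ε) := by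
  unfold quadSym
  fun_prop

theorem duhamel_eq_fourierInv {n : ℕ} (ε : Fin n → ℝ) (F : SchwartzMap (ℝ × Eucl n) ℂ) (t : ℝ)
    (x : Eucl n) :
    duhamel ε (fun q => F q) (t, x) = 𝓕⁻ (F.duhamelSymbol (quadSym ε) t) x := by
  obtain ⟨C, -, hC⟩ := F.exists_norm_fourier_slice_le (Module.finrank ℝ (Eucl n) + 1)
  have hi : Integrable (fun ξ : Eucl n =>
      C * (1 + ‖ξ‖) ^ (-((Module.finrank ℝ (Eucl n) + 1 : ℕ) : ℝ))) :=
    (integrable_one_add_norm (by push_cast; linarith)).const_mul C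
  simp only [duhamel, prop, mulOp, Real.fourierInv_eq', smul_eq_mul, SchwartzMap.duhamelSymbol]
  have : IsFiniteMeasure (volume.restrict (Set.uIoc 0 t)) := ⟨by simp [Set.uIoc]⟩
  rw [intervalIntegral_integral_swap]
  · simp_rw [intervalIntegral.integral_const_mul]
  · refine Integrable.mono' (hi.comp_snd _) (Continuous.aestronglyMeasurable ?_)
      (ae_of_all _ fun p => ?_)
    · have h1 := F.continuous_fourier_slice
      have h2 := continuous_quadSym ε
      unfold Function.uncurry
      fun_prop
    · simp only [Function.uncurry, norm_mul, norm_cexp_neg_I_mul_mul,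
        norm_exp_ofReal_mul_I, one_mul]
      exact hC _ _

theorem enorm_mulOp_fourierInv_le {n : ℕ} (m : Eucl n → ℂ) {g : Eucl n → ℂ} (hg : Integrable g)
    (hc : Continuous g) (x : Eucl n) :
    ‖mulOp m (fun y => -I * 𝓕⁻ g y) x‖ₑ ≤ ‖𝓕⁻ (fun ξ => m ξ * g ξ) x‖ₑ := by
  have hmul : 𝓕 (fun y => -I * 𝓕⁻ g y) = fun ξ => -I * 𝓕 (𝓕⁻ g) ξ := by
    ext ξ
    simp only [Real.fourier_eq', smul_eq_mul, ← integral_const_mul]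
    refine integral_congr_ae (ae_of_all _ fun y => ?_)
    simp only
    ring
  by_cases h : Integrable (𝓕⁻ g)
  · have hinv : 𝓕 (𝓕⁻ g) = g := by
      refine hc.fourier_fourierInv_eq hg ?_
      have := h.comp_neg
      refine this.congr (ae_of_all _ fun y => ?_)
      simp [Real.fourierInv_eq_fourier_neg]
    rw [mulOp, hmul, hinv]
    have : 𝓕⁻ (fun ξ => m ξ * (-I * g ξ)) x = -I * 𝓕⁻ (fun ξ => m ξ * g ξ) x := by
      simp only [Real.fourierInv_eq', smul_eq_mul, ← integral_const_mul]
      refine integral_congr_ae (ae_of_all _ fun y => ?_)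
      simp only
      ring
    rw [this, enorm_mul, ← ofReal_norm (-I)]
    simp
  · have h0 : 𝓕 (𝓕⁻ g) = 0 := by
      ext ξ
      rw [Real.fourier_eq]
      refine integral_undef fun h' => h ?_
      exact (Real.fourierIntegral_convergent_iff ξ).1 h'
    rw [mulOp, hmul, h0]
    simp [Real.fourierInv_eq']

theorem innerQ_two_sq {n : ℕ} (e : Eucl n) (u : ℝ × Eucl n → ℂ) (r : ℝ) :
    innerQ 2 e u r ^ 2 =
      ∫⁻ p : ℝ × hyperplane e, ‖u (p.1, r • e + (p.2 : Eucl n))‖ₑ ^ 2 :=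
  eLpNorm_two_sq _ _

theorem innerQ_two_eq {n : ℕ} (e : Eucl n) {u : ℝ × Eucl n → ℂ} (hu : Continuous u) (r : ℝ) :
    innerQ 2 e u r =
      (∫⁻ s, ∫⁻ v : hyperplane e, ‖u (s, r • e + (v : Eucl n))‖ₑ ^ 2) ^ (1 / 2 : ℝ) := by
  have h : innerQ 2 e u r ^ 2 =
      ∫⁻ s, ∫⁻ v : hyperplane e, ‖u (s, r • e + (v : Eucl n))‖ₑ ^ 2 := by
    rw [innerQ_two_sq, Measure.volume_eq_prod, lintegral_prod]
    exact ((hu.comp (f := fun p : ℝ × hyperplane e => (p.1, r • e + (p.2 : Eucl n)))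
      (by fun_prop)).measurable.enorm.pow_const 2).aemeasurable
  rw [← h, ← ENNReal.rpow_natCast, ← ENNReal.rpow_mul]
  norm_num

/-- inhomogeneous smoothing `‖D_{e_±} u‖_{L^{∞,2}_e} ≤ C‖F‖_{L^{1,2}_e}`
for `u(t) = -i∫_0^t W_±(t-s)F(s)ds`. -/
theorem inhomogeneous_smoothing
    (n : ℕ) (hn : 2 ≤ n) (ε : Fin n → ℝ) (hε : ∀ i, ε i = 1 ∨ ε i = -1) :
    ∃ C : ℝ, 0 < C ∧ ∀ (F : SchwartzMap (ℝ × Eucl n) ℂ) (e : Eucl n), ‖e‖ = 1 →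
      aniNorm ∞ 2 e
        (mulOpT (fun ξ => ((inner ℝ ξ (epm ε e) : ℝ) : ℂ))
          (fun p => -Complex.I * duhamel ε (fun q => F q) p))
      ≤ ENNReal.ofReal C * aniNorm 1 2 e (fun q => F q) := by
  refine ⟨4 * Real.pi, by positivity, fun F e he => ?_⟩
  have hq := continuous_quadSym ε
  simp only [aniNorm, if_true, ENNReal.one_ne_top, if_false, ENNReal.toReal_one, ENNReal.rpow_one,
    div_one]
  refine essSup_le_of_ae_le _ (ae_of_all _ fun x => ?_)
  rw [← (ENNReal.pow_right_strictMono two_ne_zero).le_iff_le]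
  simp only [innerQ_two_sq]
  have hc : ∀ t, Continuous (F.duhamelSymbol (quadSym ε) t) := fun t =>
    (F.continuous_duhamelSymbol hq).comp (Continuous.prodMk_right t)
  have key := F.lintegral_fourierInv_duhamelSymbol_sq_le he (K := hyperplane e) rfl hq
    (fun ρ η => quadSym_smul_add ε e (η : Eucl n) ρ)
    (fun ρ η => inner_smul_add_epm ε e (η : Eucl n) ρ) x
  simp_rw [← innerQ_two_eq e F.continuous] at key
  calc _ ≤ ∫⁻ p : ℝ × hyperplane e, ‖𝓕⁻ (fun ξ => ((⟪ξ, epm ε e⟫ : ℝ) : ℂ) *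
          F.duhamelSymbol (quadSym ε) p.1 ξ) (x • e + (p.2 : Eucl n))‖ₑ ^ 2 := by
        refine lintegral_mono fun p => ?_
        gcongr
        simp only [mulOpT, duhamel_eq_fourierInv]
        exact enorm_mulOp_fourierInv_le _ (F.integrable_duhamelSymbol hq p.1) (hc p.1) _
    _ ≤ ∫⁻ t, ∫⁻ v : hyperplane e, ‖𝓕⁻ (fun ξ => ((⟪ξ, epm ε e⟫ : ℝ) : ℂ) *
          F.duhamelSymbol (quadSym ε) t ξ) (x • e + (v : Eucl n))‖ₑ ^ 2 := by
        rw [Measure.volume_eq_prod]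
        exact lintegral_prod_le _
    _ ≤ 2 * (ENNReal.ofReal (2 * Real.pi) * ∫⁻ r, innerQ 2 e (fun q => F q) r) ^ 2 := key
    _ ≤ 2 ^ 2 * (ENNReal.ofReal (2 * Real.pi) * ∫⁻ r, innerQ 2 e (fun q => F q) r) ^ 2 := by
        gcongr
        norm_num
    _ = _ := by
        rw [← mul_pow, ← mul_assoc, show 4 * Real.pi = 2 * (2 * Real.pi) by ring,
          ENNReal.ofReal_mul (p := 2) (q := 2 * Real.pi) zero_le_two, ENNReal.ofReal_ofNat]
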